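/- arXiv:1604.02067 — 2 statements merged into one kernel-verified Lean document; each statement's English description precedes it below -/
import Mathlib

section
/- Fix integers m ≥ 2, n ≥ 4, and 1 ≤ h ≤ n − 3. There exists a constant C > 0 such that for every finite field F with q elements (where, if m > 2, the characteristic of F is assumed greater than n), | (1/q^n) · Σ_{f ∈ M_n(F)} ( Σ_{g ∈ F[x], deg g ≤ h} Λ(f + g) )^m − q^{(h+1)m} | ≤ C·q^{(h+1)(m−1)}. -/
open scoped Classical

/-- The von Mangoldt function for polynomials over a field: `Λ f = deg g` if `f = g ^ k` for
some irreducible `g` and some `k ≥ 1`, and `Λ f = 0` otherwise. (For `f` a prime power, the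
degree of the irreducible `g` is independent of the choice of witness.) -/
noncomputable def polyVonMangoldt {F : Type*} [Field F] (f : Polynomial F) : ℕ :=
  if h : ∃ g : Polynomial F, Irreducible g ∧ ∃ k : ℕ, 1 ≤ k ∧ f = g ^ k
  then h.choose.natDegree else 0

/-- The monic polynomial `X ^ n + ∑_{j < n} c j * X ^ j`; as `c` ranges over `Fin n → F`
this enumerates the monic polynomials of degree `n` exactly once. -/
noncomputable def monicOfCoeffs {F : Type*} [Field F] (n : ℕ) (c : Fin n → F) : Polynomial F :=
  Polynomial.X ^ n + ∑ j : Fin n, Polynomial.C (c j) * Polynomial.X ^ (j : ℕ)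

section AuxiliaryResults

open Finset

/-- Elements `x` and `y 0 = 1, y 1, …, y d` of a ring satisfying
`y (j + 1) ^ q = y (j + 1) - x * y j`.
These are the coordinates on the Lang covering of the line `x` by the group of units
`1 + y 1 T + ⋯ + y d T ^ d` modulo `T ^ (d + 1)`. -/
structure IsLangTower {B : Type*} [CommRing B] (q d : ℕ) (x : B) (y : ℕ → B) : Prop where
  zero : y 0 = 1
  step : ∀ j < d, y (j + 1) ^ q = y (j + 1) - x * y j

/-- The monomial `x ^ a * ∏ j, y (j + 1) ^ b j`, with exponents `t = (a, b)`. -/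
def towerMonomial {B : Type*} [CommRing B] {d : ℕ} (x : B) (y : ℕ → B) (t : ℕ × (Fin d → ℕ)) : B :=
  x ^ t.1 * ∏ j : Fin d, y (j + 1) ^ t.2 j

/-- Exponent vectors all of whose `y`-exponents are less than `q`. -/
def IsReducedExp {d : ℕ} (q : ℕ) (t : ℕ × (Fin d → ℕ)) : Prop := ∀ j, t.2 j < q

/-- The pole order at infinity of a monomial. -/
def towerWeight {d : ℕ} (q : ℕ) (t : ℕ × (Fin d → ℕ)) : ℕ :=
  t.1 * q ^ d + ∑ j : Fin d, t.2 j * (q ^ (d - (j + 1)) * ∑ i ∈ range (j + 1), q ^ i)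

section Span

variable {B : Type*} [CommRing B] {d : ℕ} (x : B) (y : ℕ → B)

lemma towerMonomial_add (s t : ℕ × (Fin d → ℕ)) :
    towerMonomial x y (s + t) = towerMonomial x y s * towerMonomial x y t := by
  simp only [towerMonomial, Prod.fst_add, Prod.snd_add, Pi.add_apply, pow_add, prod_mul_distrib]
  ring

lemma towerMonomial_single (j : Fin d) (c : ℕ) :
    towerMonomial x y ((0, Pi.single j c) : ℕ × (Fin d → ℕ)) = y (j + 1) ^ c := by
  simp only [towerMonomial, pow_zero, one_mul]
  rw [prod_eq_single j]
  · simp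
  · intro i _ hi; simp [hi]
  · simp

lemma towerMonomial_fst (a : ℕ) :
    towerMonomial x y ((a, 0) : ℕ × (Fin d → ℕ)) = x ^ a := by
  simp [towerMonomial]

/-- The span of the reduced monomials. -/
def towerSpan (k : Type*) [CommRing k] [Algebra k B] (q d : ℕ) (x : B) (y : ℕ → B) :
    Submodule k B :=
  Submodule.span k (towerMonomial x y '' {t : ℕ × (Fin d → ℕ) | IsReducedExp q t})

variable (k : Type*) [CommRing k] [Algebra k B] {q : ℕ}

variable {x y} in
lemma towerMonomial_mem_towerSpan {t : ℕ × (Fin d → ℕ)} (ht : IsReducedExp q t) :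
    towerMonomial x y t ∈ towerSpan k q d x y :=
  Submodule.subset_span ⟨t, ht, rfl⟩

lemma towerSpan_mul_mem_of_forall (z : B)
    (h : ∀ t : ℕ × (Fin d → ℕ), IsReducedExp q t → z * towerMonomial x y t ∈ towerSpan k q d x y)
    {f : B} (hf : f ∈ towerSpan k q d x y) : z * f ∈ towerSpan k q d x y := by
  have : towerSpan k q d x y ≤ (towerSpan k q d x y).comap (LinearMap.mulLeft k z) := by
    conv_lhs => rw [towerSpan]
    rw [Submodule.span_le]
    rintro _ ⟨t, ht, rfl⟩
    exact h t ht
  exact this hf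

lemma towerSpan_x_mul_mem {f : B} (hf : f ∈ towerSpan k q d x y) :
    x * f ∈ towerSpan k q d x y := by
  refine towerSpan_mul_mem_of_forall x y k x (fun t ht => ?_) hf
  have := towerMonomial_mem_towerSpan (x := x) (y := y) k
    (t := ((1, 0) : ℕ × (Fin d → ℕ)) + t) (fun j => by simpa using ht j)
  rwa [towerMonomial_add, towerMonomial_fst, pow_one] at this

variable {x y} in
lemma IsLangTower.towerSpan_y_mul_mem (h : IsLangTower q d x y) (hq : 2 ≤ q) {j : ℕ} (hj : j ≤ d)
    {f : B} (hf : f ∈ towerSpan k q d x y) : y j * f ∈ towerSpan k q d x y := by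
  induction j generalizing f with
  | zero => simpa [h.zero] using hf
  | succ j ih =>
    refine towerSpan_mul_mem_of_forall x y k _ (fun t ht => ?_) hf
    obtain ⟨a, b⟩ := t
    set i : Fin d := ⟨j, hj⟩
    have hi : y (j + 1) = towerMonomial x y ((0, Pi.single i 1) : ℕ × (Fin d → ℕ)) := by
      rw [towerMonomial_single, pow_one]
    by_cases hb : b i + 1 < q
    · rw [hi, ← towerMonomial_add]
      refine towerMonomial_mem_towerSpan k (fun l => ?_)
      by_cases hl : l = i
      · subst hl; simpa [add_comm] using hb
      · simpa [hl] using ht l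
    · have hbi : b i + 1 = q := le_antisymm (ht i) (not_lt.1 hb)
      set b' : Fin d → ℕ := Function.update b i 0
      have hbb : (a, b) = (0, Pi.single i (b i)) + (a, b') := by
        ext l
        · simp
        · by_cases hl : l = i
          · subst hl; simp [b']
          · simp [b', hl]
      have hb' : IsReducedExp q (a, b') := by
        intro l
        by_cases hl : l = i
        · subst hl; simp [b']; omega
        · simpa [b', hl] using ht l
      have hmem := towerMonomial_mem_towerSpan (x := x) (y := y) k hb'
      have hmem' : y (j + 1) * towerMonomial x y (a, b') ∈ towerSpan k q d x y := by
        rw [hi, ← towerMonomial_add]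
        refine towerMonomial_mem_towerSpan k (fun l => ?_)
        by_cases hl : l = i
        · subst hl; simp [b']; omega
        · simpa [b', hl] using ht l
      have key : y (j + 1) * towerMonomial x y (a, b)
          = y (j + 1) * towerMonomial x y (a, b') - y j * (x * towerMonomial x y (a, b')) := by
        rw [hbb, towerMonomial_add, towerMonomial_single]
        have := h.step j hj
        rw [← hbi, pow_succ] at this
        simp only [i] at this ⊢
        linear_combination towerMonomial x y (a, b') * this
      rw [key]
      exact sub_mem hmem' (ih (by omega) (towerSpan_x_mul_mem x y k hmem))

variable {x y} in
lemma IsLangTower.one_mem_towerSpan (hq : 2 ≤ q) : 1 ∈ towerSpan k q d x y := by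
  have := towerMonomial_mem_towerSpan (x := x) (y := y) k (q := q)
    (t := ((0, 0) : ℕ × (Fin d → ℕ))) (fun j => by simp; omega)
  simpa [towerMonomial_fst] using this

variable {x y} in
lemma IsLangTower.towerSpan_mul_mem (h : IsLangTower q d x y) (hq : 2 ≤ q) {f g : B}
    (hf : f ∈ towerSpan k q d x y) (hg : g ∈ towerSpan k q d x y) :
    f * g ∈ towerSpan k q d x y := by
  have hpow : ∀ z : B, (∀ u ∈ towerSpan k q d x y, z * u ∈ towerSpan k q d x y) →
      ∀ n : ℕ, ∀ u ∈ towerSpan k q d x y, z ^ n * u ∈ towerSpan k q d x y := by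
    intro z hz n
    induction n with
    | zero => intro u hu; simpa using hu
    | succ n ih => intro u hu; rw [pow_succ', mul_assoc]; exact hz _ (ih u hu)
  rw [mul_comm]
  refine towerSpan_mul_mem_of_forall x y k g (fun t _ => ?_) hf
  rw [mul_comm, towerMonomial, mul_assoc]
  refine hpow x (fun u hu => towerSpan_x_mul_mem x y k hu) _ _ ?_
  have : ∀ s : Finset (Fin d), (∏ j ∈ s, y (j + 1) ^ t.2 j) * g ∈ towerSpan k q d x y := by
    intro s
    induction s using Finset.induction_on with
    | empty => simpa using hg
    | insert i s his ih =>
      rw [prod_insert his, mul_assoc]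
      exact hpow _ (fun u hu => h.towerSpan_y_mul_mem k hq i.2 hu) _ _ ih
  exact this univ

variable {x y} in
lemma IsLangTower.towerSpan_pow_mem (h : IsLangTower q d x y) (hq : 2 ≤ q) {f : B}
    (hf : f ∈ towerSpan k q d x y) (n : ℕ) : f ^ n ∈ towerSpan k q d x y := by
  induction n with
  | zero => simpa using IsLangTower.one_mem_towerSpan k hq
  | succ n ih => rw [pow_succ]; exact h.towerSpan_mul_mem k hq ih hf

variable {x y} in
lemma IsLangTower.towerSpan_prod_mem (h : IsLangTower q d x y) (hq : 2 ≤ q) {ι : Type*}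
    {s : Finset ι} {f : ι → B} (hf : ∀ i ∈ s, f i ∈ towerSpan k q d x y) :
    ∏ i ∈ s, f i ∈ towerSpan k q d x y := by
  induction s using Finset.induction_on with
  | empty => simpa using IsLangTower.one_mem_towerSpan k hq
  | insert i s his ih =>
    rw [prod_insert his]
    exact h.towerSpan_mul_mem k hq (hf i (mem_insert_self _ _))
      (ih fun j hj => hf j (mem_insert_of_mem hj))

variable {x y} in
lemma IsLangTower.y_mem_towerSpan (h : IsLangTower q d x y) (hq : 2 ≤ q) {j : ℕ} (hj : j ≤ d) :
    y j ∈ towerSpan k q d x y := by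
  simpa using h.towerSpan_y_mul_mem k hq hj (IsLangTower.one_mem_towerSpan k hq)

lemma x_mem_towerSpan (hq : 2 ≤ q) : x ∈ towerSpan k q d x y := by
  simpa using towerSpan_x_mul_mem x y k (IsLangTower.one_mem_towerSpan k hq)

end Span

section Weight

lemma towerWeight_add {d q : ℕ} (s t : ℕ × (Fin d → ℕ)) :
    towerWeight q (s + t) = towerWeight q s + towerWeight q t := by
  simp only [towerWeight, Prod.fst_add, Prod.snd_add, Pi.add_apply, add_mul, sum_add_distrib]
  ring

lemma towerWeight_succ {d q : ℕ} (a : ℕ) (b : Fin (d + 1) → ℕ) :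
    towerWeight q (a, b) =
      q * towerWeight q (a, fun j : Fin d => b j.castSucc) +
        b (Fin.last d) * ∑ i ∈ range (d + 1), q ^ i := by
  simp only [towerWeight, Fin.sum_univ_castSucc, Fin.val_last, Nat.sub_self, pow_zero, one_mul,
    Fin.val_castSucc]
  rw [mul_add, mul_sum (s := univ), ← add_assoc]
  congr 2
  · ring
  · refine sum_congr rfl fun j _ => ?_
    have : d + 1 - (j.1 + 1) = (d - (j.1 + 1)) + 1 := by omega
    rw [this]; ring

lemma towerWeight_injOn {q : ℕ} : ∀ {d : ℕ} {s t : ℕ × (Fin d → ℕ)}, IsReducedExp q s →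
    IsReducedExp q t → towerWeight q s = towerWeight q t → s = t
  | 0, s, t, _, _, h => by
    obtain ⟨a, b⟩ := s
    obtain ⟨a', b'⟩ := t
    simp [towerWeight] at h
    rw [h, Subsingleton.elim b b']
  | d + 1, s, t, hs, ht, h => by
    obtain ⟨a, b⟩ := s
    obtain ⟨a', b'⟩ := t
    have hq : 0 < q := (Nat.zero_le _).trans_lt (hs 0)
    rw [towerWeight_succ, towerWeight_succ, sum_range_succ'] at h
    have h1 : b (Fin.last d) % q = b' (Fin.last d) % q := by
      have := congrArg (· % q) h
      simp only [pow_succ', ← mul_sum, pow_zero, mul_add, mul_one] at this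
      rw [mul_left_comm _ q, mul_left_comm _ q, ← add_assoc, ← add_assoc, ← mul_add, ← mul_add,
        Nat.mul_add_mod, Nat.mul_add_mod] at this
      exact this
    rw [Nat.mod_eq_of_lt (hs _), Nat.mod_eq_of_lt (ht _)] at h1
    change b _ = b' _ at h1
    rw [h1] at h
    have h2 := Nat.eq_of_mul_eq_mul_left hq (Nat.add_right_cancel h)
    have h3 := towerWeight_injOn (fun j => hs j.castSucc) (fun j => ht j.castSucc) h2
    simp only [Prod.mk.injEq] at h3
    ext j
    · exact h3.1
    · refine Fin.lastCases ?_ (fun i => ?_) j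
      · exact h1
      · exact congrFun h3.2 i

/-- The reduced exponent vectors of weight at most `M`. -/
def reducedExponents (q d M : ℕ) : Finset (ℕ × (Fin d → ℕ)) :=
  ((range (M + 1)) ×ˢ Fintype.piFinset (fun _ => range q)).filter (fun t => towerWeight q t ≤ M)

lemma mem_reducedExponents {q d M : ℕ} (hq : 0 < q) {t : ℕ × (Fin d → ℕ)} :
    t ∈ reducedExponents q d M ↔ IsReducedExp q t ∧ towerWeight q t ≤ M := by
  simp only [reducedExponents, mem_filter, mem_product, mem_range,
    Fintype.mem_piFinset, IsReducedExp]
  refine ⟨fun h => ⟨h.1.2, h.2⟩, fun h => ⟨⟨?_, h.1⟩, h.2⟩⟩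
  have : t.1 * 1 ≤ t.1 * q ^ d := Nat.mul_le_mul_left _ (Nat.one_le_pow _ _ hq)
  have := h.2
  rw [towerWeight] at this
  omega

lemma card_reducedExponents_le {q d : ℕ} (hq : 0 < q) (M : ℕ) :
    #(reducedExponents q d M) ≤ M + 1 := by
  rw [← card_range (M + 1)]
  refine card_le_card_of_injOn (towerWeight q) (fun t ht => ?_) (fun s hs t ht h => ?_)
  · have := ((mem_reducedExponents hq).1 ht).2
    simp; omega
  · exact towerWeight_injOn ((mem_reducedExponents hq).1 hs).1
      ((mem_reducedExponents hq).1 ht).1 h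

lemma card_reducedExponents_add_le {q d : ℕ} (hq : 0 < q) (M δ : ℕ) :
    #(reducedExponents q d (M + δ)) ≤ #(reducedExponents q d M) + δ := by
  have hsub : reducedExponents q d M ⊆ reducedExponents q d (M + δ) := fun t ht => by
    rw [mem_reducedExponents hq] at ht ⊢
    exact ⟨ht.1, by omega⟩
  rw [← card_sdiff_add_card_eq_card hsub, add_comm]
  gcongr
  have : δ = #(Ioc M (M + δ)) := by simp
  rw [this]
  refine card_le_card_of_injOn (towerWeight q) (fun t ht => ?_) (fun s hs t ht h => ?_)
  · simp only [coe_sdiff, Set.mem_sdiff, mem_coe, mem_reducedExponents hq] at ht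
    simp only [coe_Ioc, Set.mem_Ioc]
    have : ¬ towerWeight q t ≤ M := fun h => ht.2 ⟨ht.1.1, h⟩
    omega
  · simp only [coe_sdiff, Set.mem_sdiff, mem_coe, mem_reducedExponents hq] at hs ht
    exact towerWeight_injOn hs.1.1 ht.1.1 h

lemma exists_le_card_reducedExponents_add {q : ℕ} (d : ℕ) (hq : 0 < q) :
    ∃ g : ℕ, ∀ M : ℕ, M ≤ #(reducedExponents q d M) + g := by
  set W : (Fin d → ℕ) → ℕ := fun b => towerWeight q (0, b) with hW
  have hwt : ∀ a b, towerWeight q (a, b) = a * q ^ d + W b := by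
    intro a b; simp [hW, towerWeight]
  set P : Finset (Fin d → ℕ) := Fintype.piFinset (fun _ => range q) with hP
  have hPc : #P = q ^ d := by simp [hP, Fintype.card_piFinset]
  have hqd : 0 < q ^ d := Nat.pow_pos hq
  refine ⟨P.sup W, fun M => ?_⟩
  set g := P.sup W
  by_cases hM : M ≤ g
  · omega
  set N := (M - g) / q ^ d + 1
  have hsub : range N ×ˢ P ⊆ reducedExponents q d M := by
    rintro ⟨a, b⟩ hab
    simp only [mem_product, mem_range] at hab
    rw [mem_reducedExponents hq, hwt]
    refine ⟨fun j => by simpa using (Fintype.mem_piFinset.1 hab.2) j, ?_⟩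
    have h1 : W b ≤ g := le_sup (f := W) hab.2
    have h2 : a * q ^ d ≤ M - g :=
      (Nat.mul_le_mul_right _ (Nat.lt_succ_iff.1 hab.1)).trans (Nat.div_mul_le_self _ _)
    omega
  have h1 := card_le_card hsub
  rw [card_product, card_range, hPc] at h1
  have h2 : M - g < N * q ^ d := by
    have := Nat.lt_mul_div_succ (M - g) hqd
    rwa [mul_comm] at this
  omega

end Weight

section Valuation

universe u in
lemma exists_isAlgClosed_valuation (K : Type u) [Field K] :
    ∃ (L : Type u) (_ : Field L) (_ : Algebra K L) (_ : IsAlgClosed L) (V : ValuationSubring L)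
      (x : L), (∀ c : K, V.valuation (algebraMap K L c) ≤ 1) ∧ 1 < V.valuation x := by
  let L := AlgebraicClosure (RatFunc K)
  let x : L := algebraMap (RatFunc K) L RatFunc.X
  let R : Subring L := (integralClosure K L).toSubring
  have hx : x ∉ R := by
    intro h
    have h1 : IsIntegral K x := h
    have h2 : IsAlgebraic K (RatFunc.X : RatFunc K) :=
      (isAlgebraic_algebraMap_iff (algebraMap (RatFunc K) L).injective).1 h1.isAlgebraic
    exact RatFunc.transcendental_X h2
  have : IsIntegrallyClosedIn R L :=
    inferInstanceAs (IsIntegrallyClosedIn (integralClosure K L) L)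
  obtain ⟨V, hV, hxV⟩ := Subring.exists_le_valuationSubring_of_isIntegrallyClosedIn hx
  refine ⟨L, inferInstance, inferInstance, inferInstance, V, x, fun c => ?_, ?_⟩
  · rw [V.valuation_le_one_iff]
    exact hV (algebraMap_mem (integralClosure K L) c)
  · exact not_le.1 fun h => hxV ((V.valuation_le_one_iff _).1 h)

variable {L Γ : Type*} [Field L] [LinearOrderedCommGroupWithZero Γ] (v : Valuation L Γ)
  {k : Type*} [Field k] [Algebra k L]

lemma valuation_algebraMap_eq_one (hk : ∀ c : k, v (algebraMap k L c) ≤ 1) {c : k} (hc : c ≠ 0) :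
    v (algebraMap k L c) = 1 := by
  refine le_antisymm (hk c) ?_
  have h1 := hk c⁻¹
  rw [map_inv₀, map_inv₀] at h1
  exact (inv_le_one₀ (zero_lt_iff.2 (by simpa using hc))).1 h1

lemma pow_le_valuation_sum_pow (hk : ∀ c : k, v (algebraMap k L c) ≤ 1) {ι : Type*}
    (s : Finset ι) (u : ι → L) (c : ι → k) {D : ℕ} {γ : Γ} (hγ : 1 < γ) (ω : ι → ℕ)
    (hω : Set.InjOn ω s) (hu : ∀ i ∈ s, v (u i) ^ D = γ ^ ω i) {i₀ : ι} (hi₀ : i₀ ∈ s)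
    (hc : c i₀ ≠ 0) : γ ^ ω i₀ ≤ v (∑ i ∈ s, c i • u i) ^ D := by
  set s' := s.filter (fun i => c i ≠ 0)
  have hi₀' : i₀ ∈ s' := by simp [s', hi₀, hc]
  obtain ⟨j, hj, hmax⟩ := s'.exists_max_image ω ⟨i₀, hi₀'⟩
  have hjs : j ∈ s ∧ c j ≠ 0 := by simpa [s'] using hj
  have hsum : ∑ i ∈ s, c i • u i = ∑ i ∈ s', c i • u i := by
    refine (sum_subset (filter_subset _ _) fun i hi hi' => ?_).symm
    have : c i = 0 := by simpa [s', hi] using hi'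
    simp [this]
  have hval : ∀ i ∈ s', v (c i • u i) = v (u i) := fun i hi => by
    rw [Algebra.smul_def, map_mul,
      valuation_algebraMap_eq_one v hk (by simp [s'] at hi; exact hi.2),
      one_mul]
  have hv : v (∑ i ∈ s', c i • u i) = v (u j) := by
    rw [← hval j hj]
    refine Valuation.map_sum_eq_of_lt v hj fun i hi => ?_
    simp only [mem_sdiff, mem_singleton] at hi
    rw [hval i hi.1, hval j hj]
    have his : i ∈ s := (mem_filter.1 hi.1).1
    refine lt_of_pow_lt_pow_left₀ D zero_le ?_
    rw [hu i his, hu j hjs.1]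
    exact pow_lt_pow_right₀ hγ (lt_of_le_of_ne (hmax i hi.1) fun h => hi.2 (hω his hjs.1 h))
  rw [hsum, hv, hu j hjs.1]
  exact pow_le_pow_right₀ hγ.le (hmax _ hi₀')

variable {q d : ℕ} {x : L} {y : ℕ → L}

lemma IsLangTower.valuation_y_pow (h : IsLangTower q d x y) (hq : 2 ≤ q) (hx : 1 < v x) {j : ℕ}
    (hj : j ≤ d) : 1 ≤ v (y j) ∧ v (y j) ^ q ^ j = v x ^ ∑ i ∈ range j, q ^ i := by
  induction j with
  | zero => simp [h.zero]
  | succ j ih =>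
    obtain ⟨h1, h2⟩ := ih (by omega)
    have hw : y (j + 1) - y (j + 1) ^ q = x * y j := by rw [h.step j hj]; ring
    have hv : 1 < v (x * y j) := by
      rw [map_mul]; exact one_lt_mul_of_lt_of_le hx h1
    have hy : 1 < v (y (j + 1)) := by
      by_contra hle
      rw [not_lt] at hle
      rw [← hw] at hv
      refine absurd hv (not_lt.2 (Valuation.map_sub_le v hle ?_))
      rw [map_pow]
      exact pow_le_one₀ zero_le hle
    have hlt : v (y (j + 1)) < v (y (j + 1) ^ q) := by
      rw [map_pow]
      conv_lhs => rw [← pow_one (v (y (j + 1)))]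
      exact pow_lt_pow_right₀ hy (by omega)
    have heq : v (y (j + 1)) ^ q = v x * v (y j) := by
      rw [← map_mul, ← hw, Valuation.map_sub_eq_of_lt_right v hlt, map_pow]
    refine ⟨hy.le, ?_⟩
    rw [pow_succ', pow_mul, heq, mul_pow, h2, ← pow_add, sum_range_succ, add_comm]

lemma IsLangTower.valuation_y_le (h : IsLangTower q d x y) (hq : 2 ≤ q) (hx : 1 < v x) {i j : ℕ}
    (hij : i ≤ j) (hj : j ≤ d) : v (y i) ≤ v (y j) := by
  induction j, hij using Nat.le_induction with
  | base => exact le_rfl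
  | succ j hij ih =>
    refine (ih (by omega)).trans ?_
    have h1 := (h.valuation_y_pow v hq hx hj).2
    have h2 := (h.valuation_y_pow v hq hx (j := j) (by omega)).2
    refine le_of_pow_le_pow_left₀ (n := q ^ (j + 1)) (by positivity) zero_le ?_
    rw [h1, pow_succ, pow_mul, h2, ← pow_mul]
    refine pow_le_pow_right₀ hx.le ?_
    rw [sum_range_succ', sum_mul]
    simp [pow_succ]

lemma IsLangTower.valuation_towerMonomial_pow (h : IsLangTower q d x y) (hq : 2 ≤ q)
    (hx : 1 < v x) (t : ℕ × (Fin d → ℕ)) :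
    v (towerMonomial x y t) ^ q ^ d = v x ^ towerWeight q t := by
  rw [towerMonomial, map_mul, map_pow, map_prod, mul_pow, towerWeight, pow_add, ← pow_mul,
    ← prod_pow, ← prod_pow_eq_pow_sum]
  congr 1
  refine prod_congr rfl fun j _ => ?_
  have h1 := (h.valuation_y_pow v hq hx (j := j + 1) j.2).2
  have h2 : q ^ d = q ^ (j.1 + 1) * q ^ (d - (j.1 + 1)) := by
    rw [← pow_add]; congr 1; have := j.2; omega
  rw [map_pow, ← pow_mul, mul_comm, h2, mul_assoc, pow_mul, h1, ← pow_mul]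
  congr 1
  ring

lemma IsLangTower.mem_span_of_valuation_le (h : IsLangTower q d x y) (hq : 2 ≤ q)
    (hx : 1 < v x) (hk : ∀ c : k, v (algebraMap k L c) ≤ 1) {f : L}
    (hf : f ∈ towerSpan k q d x y) {M : ℕ} (hM : v f ^ q ^ d ≤ v x ^ M) :
    f ∈ Submodule.span k
      (towerMonomial x y '' (reducedExponents q d M : Set (ℕ × (Fin d → ℕ)))) := by
  rw [towerSpan, Finsupp.mem_span_image_iff_linearCombination] at hf
  obtain ⟨c, hc, rfl⟩ := hf
  rw [Finsupp.mem_span_image_iff_linearCombination]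
  refine ⟨c, ?_, rfl⟩
  rw [Finsupp.mem_supported] at hc ⊢
  intro t ht
  rw [mem_coe, mem_reducedExponents (by omega)]
  refine ⟨hc ht, ?_⟩
  rw [Finsupp.linearCombination_apply, Finsupp.sum] at hM
  have := (pow_le_valuation_sum_pow v hk c.support (towerMonomial x y) c (D := q ^ d)
    hx (towerWeight q) (fun s hs t ht => towerWeight_injOn (hc hs) (hc ht))
    (fun t _ => h.valuation_towerMonomial_pow v hq hx t) ht (by simpa using ht)).trans hM
  exact (pow_le_pow_iff_right₀ hx).1 this

lemma IsLangTower.valuation_sum_ne_zero (h : IsLangTower q d x y) (hq : 2 ≤ q)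
    (hx : 1 < v x) (hk : ∀ c : k, v (algebraMap k L c) ≤ 1) {ι : Type*} (s : Finset ι)
    (τ : ι → ℕ × (Fin d → ℕ)) (hτ : Set.InjOn (fun i => towerWeight q (τ i)) s) (c : ι → k)
    {i₀ : ι} (hi₀ : i₀ ∈ s) (hc : c i₀ ≠ 0) :
    ∑ i ∈ s, c i • towerMonomial x y (τ i) ≠ 0 := by
  intro h0
  have := pow_le_valuation_sum_pow v hk s (fun i => towerMonomial x y (τ i)) c (D := q ^ d)
    hx _ hτ (fun i _ => h.valuation_towerMonomial_pow v hq hx _) hi₀ hc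
  rw [h0, map_zero, zero_pow (by positivity)] at this
  exact absurd (le_zero_iff.1 this) (pow_ne_zero _ (zero_lt_one.trans hx).ne')

end Valuation

section ZeroCount

lemma card_le_of_linearIndependent_of_mem_span {k V ι : Type*} [Field k] [AddCommGroup V]
    [Module k V] [Fintype ι] {w : ι → V} (hw : LinearIndependent k w) {κ : Type*} (s : Finset κ)
    (e : κ → V) (hs : ∀ i, w i ∈ Submodule.span k (e '' s)) : Fintype.card ι ≤ #s := by
  rw [← finrank_span_eq_card hw]
  have : FiniteDimensional k (Submodule.span k (e '' s)) :=
    FiniteDimensional.span_of_finite k (s.finite_toSet.image e)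
  have h1 : Submodule.span k (Set.range w) ≤ Submodule.span k (e '' s) := by
    rw [Submodule.span_le]; rintro _ ⟨i, rfl⟩; exact hs i
  refine (Submodule.finrank_mono h1).trans ?_
  rw [← coe_image]
  exact (finrank_span_finset_le_card _).trans card_image_le

lemma map_mem_towerSpan {k B B' : Type*} [CommRing k] [CommRing B] [CommRing B'] [Algebra k B]
    [Algebra k B'] (φ : B →ₐ[k] B') {q d : ℕ} {x : B} {y : ℕ → B} {x' : B'} {y' : ℕ → B'}
    (hx : φ x = x') (hy : ∀ j, φ (y j) = y' j) {f : B} (hf : f ∈ towerSpan k q d x y) :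
    φ f ∈ towerSpan k q d x' y' := by
  have : towerSpan k q d x y ≤ (towerSpan k q d x' y').comap φ.toLinearMap := by
    conv_lhs => rw [towerSpan]
    rw [Submodule.span_le]
    rintro _ ⟨t, ht, rfl⟩
    have : φ (towerMonomial x y t) = towerMonomial x' y' t := by
      simp [towerMonomial, hx, hy]
    change φ (towerMonomial x y t) ∈ towerSpan k q d x' y'
    rw [this]
    exact towerMonomial_mem_towerSpan k ht
  exact this hf

lemma exists_mem_span_reducedExponents {k B : Type*} [CommRing k] [CommRing B] [Algebra k B]
    {q d : ℕ} (hq : 0 < q) {x : B} {y : ℕ → B} {f : B} (hf : f ∈ towerSpan k q d x y) :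
    ∃ M : ℕ, f ∈ Submodule.span k
      (towerMonomial x y '' (reducedExponents q d M : Set (ℕ × (Fin d → ℕ)))) := by
  rw [towerSpan, Finsupp.mem_span_image_iff_linearCombination] at hf
  obtain ⟨c, hc, rfl⟩ := hf
  refine ⟨c.support.sup (towerWeight q), ?_⟩
  rw [Finsupp.mem_span_image_iff_linearCombination]
  refine ⟨c, ?_, rfl⟩
  rw [Finsupp.mem_supported] at hc ⊢
  intro t ht
  rw [mem_coe, mem_reducedExponents hq]
  exact ⟨hc ht, le_sup (f := towerWeight q) ht⟩

lemma span_reducedExponents_mono {k B : Type*} [CommRing k] [CommRing B] [Algebra k B]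
    {q d : ℕ} (hq : 0 < q) {x : B} {y : ℕ → B} {M N : ℕ} (h : M ≤ N) :
    Submodule.span k (towerMonomial x y '' (reducedExponents q d M : Set (ℕ × (Fin d → ℕ)))) ≤
    Submodule.span k (towerMonomial x y '' (reducedExponents q d N : Set (ℕ × (Fin d → ℕ)))) := by
  refine Submodule.span_mono (Set.image_mono fun t ht => ?_)
  rw [mem_coe, mem_reducedExponents hq] at ht ⊢
  exact ⟨ht.1, ht.2.trans h⟩

variable {L Γ : Type*} [Field L] [LinearOrderedCommGroupWithZero Γ] (v : Valuation L Γ)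
  {K : Type*} [Field K] {q d : ℕ} {x : L} {y : ℕ → L}
  {Z : Type*} {xZ : Z → K} {yZ : Z → ℕ → K}

lemma IsLangTower.prod_pi (h : IsLangTower q d x y) (hZ : ∀ z, IsLangTower q d (xZ z) (yZ z)) :
    IsLangTower q d ((x, xZ) : L × (Z → K)) (fun j => (y j, fun z => yZ z j)) where
  zero := by
    ext z
    · exact h.zero
    · exact (hZ z).zero
  step j hj := by
    ext z
    · simpa using h.step j hj
    · simpa using (hZ z).step j hj

variable (k : Type*) [Field k] [Algebra k L] [Algebra k K]

lemma IsLangTower.eq_zero_of_fst_eq_zero (h : IsLangTower q d x y) (hq : 2 ≤ q)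
    (hx : 1 < v x) (hk : ∀ c : k, v (algebraMap k L c) ≤ 1) {f : L × (Z → K)}
    (hf : f ∈ towerSpan k q d ((x, xZ) : L × (Z → K)) (fun j => (y j, fun z => yZ z j)))
    (h0 : f.1 = 0) : f = 0 := by
  rw [towerSpan, Finsupp.mem_span_image_iff_linearCombination] at hf
  obtain ⟨c, hc, rfl⟩ := hf
  rw [Finsupp.mem_supported] at hc
  rw [Finsupp.linearCombination_apply, Finsupp.sum] at h0 ⊢
  by_cases hs : c.support = ∅
  · simp [hs]
  · obtain ⟨t, ht⟩ := nonempty_iff_ne_empty.2 hs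
    refine absurd ?_ (h.valuation_sum_ne_zero v hq hx hk c.support id
      (fun s hs t ht => towerWeight_injOn (hc hs) (hc ht)) c ht (by simpa using ht))
    rw [← h0, Prod.fst_sum]
    refine sum_congr rfl fun t _ => ?_
    simp [towerMonomial, Prod.fst_prod]

variable [Algebra K L] {k}

lemma IsLangTower.exists_interpolation [Fintype Z]
    (h : IsLangTower q d x y) (hZ : ∀ z, IsLangTower q d (xZ z) (yZ z)) (hq : 2 ≤ q)
    (hsep : ∀ z z', xZ z = xZ z' → (∀ j < d, yZ z (j + 1) = yZ z' (j + 1)) → z = z') (z : Z) :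
    ∃ f ∈ towerSpan K q d ((x, xZ) : L × (Z → K)) (fun j => (y j, fun z => yZ z j)),
      f.2 z ≠ 0 ∧ ∀ z' ≠ z, f.2 z' = 0 := by
  have hB := h.prod_pi hZ
  have hpair : ∀ z' ∈ univ.erase z,
      ∃ f ∈ towerSpan K q d ((x, xZ) : L × (Z → K)) (fun j => (y j, fun z => yZ z j)),
      f.2 z ≠ 0 ∧ f.2 z' = 0 := by
    intro z' hz'
    have hne : z' ≠ z := ne_of_mem_erase hz'
    by_cases hxx : xZ z = xZ z'
    · have : ∃ j < d, yZ z (j + 1) ≠ yZ z' (j + 1) := by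
        by_contra! hcon
        exact hne (hsep z z' hxx hcon).symm
      obtain ⟨j, hj, hyy⟩ := this
      refine ⟨_, sub_mem (hB.y_mem_towerSpan K hq (j := j + 1) hj)
        (Submodule.smul_mem _ (yZ z' (j + 1)) (IsLangTower.one_mem_towerSpan K hq)), ?_, ?_⟩
      · simpa [sub_eq_zero] using hyy
      · simp
    · refine ⟨_, sub_mem (x_mem_towerSpan _ _ K hq)
        (Submodule.smul_mem _ (xZ z') (IsLangTower.one_mem_towerSpan K hq)), ?_, ?_⟩
      · simpa [sub_eq_zero] using hxx
      · simp
  choose! u hu1 hu2 hu3 using hpair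
  refine ⟨∏ z' ∈ univ.erase z, u z', hB.towerSpan_prod_mem K hq hu1, ?_, ?_⟩
  · rw [Prod.snd_prod, prod_apply, prod_ne_zero_iff]
    exact hu2
  · intro z' hz'
    rw [Prod.snd_prod, prod_apply]
    exact prod_eq_zero (mem_erase.2 ⟨hz', mem_univ _⟩) (hu3 z' (mem_erase.2 ⟨hz', mem_univ _⟩))

lemma IsLangTower.linearIndependent_sumElim [Fintype Z]
    (h : IsLangTower q d x y) (hZ : ∀ z, IsLangTower q d (xZ z) (yZ z)) (hq : 2 ≤ q)
    (hx : 1 < v x) (hK : ∀ c : K, v (algebraMap K L c) ≤ 1)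
    {g : L × (Z → K)}
    (hg : g ∈ towerSpan K q d ((x, xZ) : L × (Z → K)) (fun j => (y j, fun z => yZ z j)))
    (hg1 : g.1 ≠ 0) (hg2 : g.2 = 0) {u : Z → L × (Z → K)}
    (hu : ∀ z, u z ∈ towerSpan K q d ((x, xZ) : L × (Z → K)) (fun j => (y j, fun z => yZ z j)))
    (hu1 : ∀ z, (u z).2 z ≠ 0) (hu2 : ∀ z, ∀ z' ≠ z, (u z).2 z' = 0) (M : ℕ) :
    LinearIndependent K (Sum.elim (fun z => (u z).1)
      (fun t : reducedExponents q d M => g.1 * towerMonomial x y t.1)) := by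
  have hq0 : 0 < q := by omega
  have hB := h.prod_pi hZ
  rw [Fintype.linearIndependent_iff]
  intro a ha
  rw [Fintype.sum_sum_type] at ha
  simp only [Sum.elim_inl, Sum.elim_inr] at ha
  set T := ∑ t : reducedExponents q d M, a (Sum.inr t) •
    towerMonomial ((x, xZ) : L × (Z → K)) (fun j => (y j, fun z => yZ z j)) t.1 with hT
  have hT1 : T.1 = ∑ t : reducedExponents q d M, a (Sum.inr t) • towerMonomial x y t.1 := by
    rw [hT, Prod.fst_sum]
    refine sum_congr rfl fun t _ => ?_
    simp [towerMonomial, Prod.fst_prod]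
  have hTm : T ∈ towerSpan K q d ((x, xZ) : L × (Z → K)) (fun j => (y j, fun z => yZ z j)) :=
    sum_mem fun t _ => Submodule.smul_mem _ _
      (towerMonomial_mem_towerSpan K ((mem_reducedExponents hq0).1 t.2).1)
  have hsum : ∑ z, a (Sum.inl z) • u z + g * T = 0 := by
    refine h.eq_zero_of_fst_eq_zero v K hq hx hK
      (add_mem (sum_mem fun z _ => Submodule.smul_mem _ _ (hu z))
        (hB.towerSpan_mul_mem K hq hg hTm)) ?_
    rw [Prod.fst_add, Prod.fst_mul, Prod.fst_sum, hT1, mul_sum, ← ha]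
    simp only [Prod.smul_fst, mul_smul_comm]
  have hz : ∀ z, a (Sum.inl z) = 0 := by
    intro z
    have h2 : (∑ z, a (Sum.inl z) • u z + g * T).2 z = 0 := by rw [hsum]; rfl
    rw [Prod.snd_add, Pi.add_apply, Prod.snd_sum, Prod.snd_mul, hg2, zero_mul,
      Pi.zero_apply, add_zero, Finset.sum_apply, sum_eq_single z] at h2
    · simpa [hu1 z] using h2
    · intro z' _ hz'
      simp [hu2 z' z hz'.symm]
    · simp
  have ht : ∑ t : reducedExponents q d M, a (Sum.inr t) • towerMonomial x y t.1 = 0 := by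
    simp only [hz, zero_smul, sum_const_zero, zero_add] at ha
    simp only [← mul_smul_comm, ← mul_sum] at ha
    exact (mul_eq_zero.1 ha).resolve_left hg1
  rintro (z | t)
  · exact hz z
  · by_contra hne
    exact h.valuation_sum_ne_zero v hq hx hK univ (fun t : reducedExponents q d M => t.1)
      (fun s _ t _ hst => Subtype.ext (towerWeight_injOn ((mem_reducedExponents hq0).1 s.2).1
        ((mem_reducedExponents hq0).1 t.2).1 hst)) (fun t => a (Sum.inr t)) (mem_univ t) hne ht

lemma IsLangTower.card_le_of_vanish [Fintype Z]
    (h : IsLangTower q d x y) (hZ : ∀ z, IsLangTower q d (xZ z) (yZ z)) (hq : 2 ≤ q)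
    (hx : 1 < v x) (hK : ∀ c : K, v (algebraMap K L c) ≤ 1)
    (hsep : ∀ z z', xZ z = xZ z' → (∀ j < d, yZ z (j + 1) = yZ z' (j + 1)) → z = z')
    {g : L × (Z → K)}
    (hg : g ∈ towerSpan K q d ((x, xZ) : L × (Z → K)) (fun j => (y j, fun z => yZ z j)))
    (hg1 : g.1 ≠ 0) (hg2 : g.2 = 0) {δ : ℕ} (hδ : v g.1 ^ q ^ d ≤ v x ^ δ) :
    Fintype.card Z ≤ δ := by
  have hq0 : 0 < q := by omega
  have hg' : g.1 ∈ towerSpan K q d x y :=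
    map_mem_towerSpan (AlgHom.fst K L (Z → K)) (x' := x) (y' := y) rfl (fun _ => rfl) hg
  choose u hu hu1 hu2 using h.exists_interpolation hZ hq hsep
  have hu' : ∀ z, (u z).1 ∈ towerSpan K q d x y := fun z =>
    map_mem_towerSpan (AlgHom.fst K L (Z → K)) (x' := x) (y' := y) rfl (fun _ => rfl) (hu z)
  choose N hN using fun z => exists_mem_span_reducedExponents hq0 (hu' z)
  set M := univ.sup N
  have hcard := card_le_of_linearIndependent_of_mem_span
    (h.linearIndependent_sumElim v hZ hq hx hK hg hg1 hg2 hu hu1 hu2 M)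
    (reducedExponents q d (M + δ)) (towerMonomial x y) (by
      rintro (z | t)
      · exact span_reducedExponents_mono hq0 ((le_sup (f := N) (mem_univ z)).trans
          (Nat.le_add_right M δ)) (hN z)
      · have ht := (mem_reducedExponents hq0).1 t.2
        refine h.mem_span_of_valuation_le v hq hx hK (h.towerSpan_mul_mem K hq hg'
          (towerMonomial_mem_towerSpan K ht.1)) ?_
        simp only [map_mul, mul_pow, h.valuation_towerMonomial_pow v hq hx]
        rw [add_comm M, pow_add]
        exact mul_le_mul' hδ (pow_le_pow_right₀ hx.le ht.2))
  have := card_reducedExponents_add_le (q := q) (d := d) hq0 M δ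
  rw [Fintype.card_sum, Fintype.card_coe] at hcard
  omega

end ZeroCount

section PointBound

lemma exists_pow_eq_sub {L : Type*} [Field L] [IsAlgClosed L] {q : ℕ} (hq : 2 ≤ q) (b : L) :
    ∃ y : L, y ^ q = y - b := by
  have hd : (Polynomial.X ^ q - (Polynomial.X - Polynomial.C b) : Polynomial L).degree = q := by
    rw [Polynomial.degree_sub_eq_left_of_degree_lt] <;>
      rw [Polynomial.degree_X_pow]
    rw [Polynomial.degree_X_sub_C]
    exact_mod_cast (by omega : 1 < q)
  obtain ⟨y, hy⟩ := IsAlgClosed.exists_root _ (by rw [hd]; exact_mod_cast (by omega : q ≠ 0))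
  refine ⟨y, ?_⟩
  simpa [sub_eq_zero] using hy

lemma exists_isLangTower {L : Type*} [Field L] [IsAlgClosed L] {q : ℕ} (hq : 2 ≤ q) (d : ℕ)
    (x : L) : ∃ y : ℕ → L, (∀ j, y (j + 1) ^ q = y (j + 1) - x * y j) ∧ IsLangTower q d x y := by
  choose r hr using exists_pow_eq_sub (L := L) hq
  have h : ∀ j, (Nat.rec 1 (fun _ a => r (x * a)) (j + 1) : L) ^ q =
      (Nat.rec 1 (fun _ a => r (x * a)) (j + 1) : L) -
        x * (Nat.rec 1 (fun _ a => r (x * a)) j : L) := fun j => hr _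
  exact ⟨fun j => Nat.rec 1 (fun _ a => r (x * a)) j, h, rfl, fun j _ => h j⟩

lemma exists_algHom_eq_pow (F K : Type*) [Field F] [Fintype F] [Field K] [Algebra F K] (s : ℕ) :
    ∃ φ : K →ₐ[F] K, ∀ a, φ a = a ^ Fintype.card F ^ s := by
  induction s with
  | zero => exact ⟨AlgHom.id F K, by simp⟩
  | succ s ih =>
    obtain ⟨φ, hφ⟩ := ih
    refine ⟨(FiniteField.frobeniusAlgHom F K).comp φ, fun a => ?_⟩
    rw [AlgHom.comp_apply, hφ, FiniteField.coe_frobeniusAlgHom, pow_succ, pow_mul]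

lemma map_towerMonomial {k B B' : Type*} [CommRing k] [CommRing B] [CommRing B'] [Algebra k B]
    [Algebra k B'] (φ : B →ₐ[k] B') {d : ℕ} (x : B) (y : ℕ → B) (t : ℕ × (Fin d → ℕ)) :
    φ (towerMonomial x y t) = towerMonomial (φ x) (fun j => φ (y j)) t := by
  simp [towerMonomial]

lemma towerMonomial_congr {B : Type*} [CommRing B] {d : ℕ} {x : B} {y y' : ℕ → B}
    (h : ∀ j < d, y (j + 1) = y' (j + 1)) (t : ℕ × (Fin d → ℕ)) :
    towerMonomial x y t = towerMonomial x y' t := by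
  simp only [towerMonomial]
  congr 1
  exact prod_congr rfl fun j _ => by rw [h j j.2]

lemma towerMonomial_nsmul {B : Type*} [CommRing B] {d : ℕ} (x : B) (y : ℕ → B) (n : ℕ)
    (t : ℕ × (Fin d → ℕ)) : towerMonomial x y (n • t) = towerMonomial x y t ^ n := by
  simp only [towerMonomial, Prod.smul_fst, Prod.smul_snd, Pi.smul_apply, smul_eq_mul, mul_pow,
    ← pow_mul, ← prod_pow, mul_comm n]

lemma towerWeight_nsmul {d q : ℕ} (n : ℕ) (t : ℕ × (Fin d → ℕ)) :
    towerWeight q (n • t) = n * towerWeight q t := by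
  simp only [towerWeight, Prod.smul_fst, Prod.smul_snd, Pi.smul_apply, smul_eq_mul, mul_add,
    mul_sum]
  simp only [mul_assoc]

lemma IsLangTower.towerMonomial_mem {k B : Type*} [CommRing k] [CommRing B] [Algebra k B]
    {q d : ℕ} {x : B} {y y' : ℕ → B} (h : IsLangTower q d x y) (hq : 2 ≤ q)
    (hy : ∀ j < d, y' (j + 1) ∈ towerSpan k q d x y) (t : ℕ × (Fin d → ℕ)) :
    towerMonomial x y' t ∈ towerSpan k q d x y :=
  h.towerSpan_mul_mem k hq (h.towerSpan_pow_mem k hq (x_mem_towerSpan x y k hq) _)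
    (h.towerSpan_prod_mem k hq fun j _ => h.towerSpan_pow_mem k hq (hy j j.2) _)

variable {L Γ : Type*} [Field L] [LinearOrderedCommGroupWithZero Γ] (v : Valuation L Γ)

lemma valuation_towerMonomial_le {d : ℕ} {x : L} {y y' : ℕ → L}
    (h : ∀ j < d, v (y' (j + 1)) ≤ v (y (j + 1))) (t : ℕ × (Fin d → ℕ)) :
    v (towerMonomial x y' t) ≤ v (towerMonomial x y t) := by
  simp only [towerMonomial, map_mul, map_pow, map_prod]
  exact mul_le_mul' le_rfl (prod_le_prod' fun j _ => pow_le_pow_left' (h j j.2) _)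

lemma valuation_sum_pow_le {ι : Type*} (s : Finset ι) (f : ι → L) {D : ℕ} (hD : D ≠ 0) {γ : Γ}
    (h : ∀ i ∈ s, v (f i) ^ D ≤ γ) : v (∑ i ∈ s, f i) ^ D ≤ γ := by
  refine sum_induction f (fun a => v a ^ D ≤ γ) (fun a b ha hb => ?_) (by simp [hD]) h
  rcases le_max_iff.1 (v.map_add a b) with h | h
  · exact (pow_le_pow_left' h D).trans ha
  · exact (pow_le_pow_left' h D).trans hb

/-- The twist of `y` by a power series with coefficients `c`. -/
def towerTwist {k B : Type*} [CommRing k] [CommRing B] [Algebra k B] (c : ℕ → k) (y : ℕ → B)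
    (j : ℕ) : B := ∑ i ∈ range (j + 1), c (j - i) • y i

lemma IsLangTower.towerTwist_mem {k B : Type*} [CommRing k] [CommRing B] [Algebra k B]
    {q d : ℕ} {x : B} {y : ℕ → B} (h : IsLangTower q d x y) (hq : 2 ≤ q) (c : ℕ → k) {j : ℕ}
    (hj : j ≤ d) : towerTwist c y j ∈ towerSpan k q d x y :=
  sum_mem fun _ hi => Submodule.smul_mem _ _
    (h.y_mem_towerSpan k hq ((Nat.lt_succ_iff.1 (mem_range.1 hi)).trans hj))

lemma IsLangTower.valuation_towerTwist_le {k : Type*} [Field k] [Algebra k L] {q d : ℕ} {x : L}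
    {y : ℕ → L} (h : IsLangTower q d x y) (hq : 2 ≤ q) (hx : 1 < v x)
    (hk : ∀ c : k, v (algebraMap k L c) ≤ 1) (c : ℕ → k) {j : ℕ} (hj : j ≤ d) :
    v (towerTwist c y j) ≤ v (y j) := by
  refine v.map_sum_le fun i hi => ?_
  rw [Algebra.smul_def, map_mul]
  exact (mul_le_of_le_one_left' (hk _)).trans
    (h.valuation_y_le v hq hx (Nat.lt_succ_iff.1 (mem_range.1 hi)) hj)

variable {k : Type*} [Field k] [Algebra k L]

lemma IsLangTower.exists_relation {q d : ℕ} {x : L} {y : ℕ → L} (h : IsLangTower q d x y)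
    (hq : 2 ≤ q) (hx : 1 < v x) (hk : ∀ c : k, v (algebraMap k L c) ≤ 1) (c : ℕ → k)
    {B m l : ℕ}
    (hcard : B * l + m + 1 < #(reducedExponents q d m) * #(reducedExponents q d l)) :
    ∃ a : reducedExponents q d m × reducedExponents q d l → k, (∃ i, a i ≠ 0) ∧
      ∑ i, a i • (towerMonomial x y i.2.1 ^ B * towerMonomial x (towerTwist c y) i.1.1) = 0 := by
  have hq0 : 0 < q := by omega
  have hdep : ¬ LinearIndependent k (fun i : reducedExponents q d m × reducedExponents q d l =>
      towerMonomial x y i.2.1 ^ B * towerMonomial x (towerTwist c y) i.1.1) := by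
    intro hind
    have := card_le_of_linearIndependent_of_mem_span hind (reducedExponents q d (B * l + m))
      (towerMonomial x y) (by
        rintro ⟨⟨i, hi⟩, ⟨j, hj⟩⟩
        rw [mem_reducedExponents hq0] at hi hj
        refine h.mem_span_of_valuation_le v hq hx hk (h.towerSpan_mul_mem k hq
          (h.towerSpan_pow_mem k hq (towerMonomial_mem_towerSpan k hj.1) _)
          (h.towerMonomial_mem hq (fun j hj => h.towerTwist_mem hq c hj) _)) ?_
        rw [map_mul, map_pow, mul_pow, ← pow_mul, mul_comm B, pow_mul,
          h.valuation_towerMonomial_pow v hq hx, ← pow_mul, pow_add]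
        refine mul_le_mul' (pow_le_pow_right₀ hx.le ?_) ?_
        · rw [mul_comm]; exact Nat.mul_le_mul_left _ hj.2
        · refine (pow_le_pow_left' (valuation_towerMonomial_le v (fun j hj =>
            h.valuation_towerTwist_le v hq hx hk c hj) i) _).trans ?_
          rw [h.valuation_towerMonomial_pow v hq hx]
          exact pow_le_pow_right₀ hx.le hi.2)
    rw [Fintype.card_prod, Fintype.card_coe, Fintype.card_coe] at this
    have := card_reducedExponents_le (d := d) hq0 (B * l + m)
    omega
  rw [Fintype.not_linearIndependent_iff] at hdep
  obtain ⟨a, ha, ha'⟩ := hdep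
  exact ⟨a, ha', ha⟩

lemma fst_towerMonomial {B₁ B₂ : Type*} [CommRing B₁] [CommRing B₂] {d : ℕ} (x : B₁ × B₂)
    (y : ℕ → B₁ × B₂) (t : ℕ × (Fin d → ℕ)) :
    (towerMonomial x y t).1 = towerMonomial x.1 (fun j => (y j).1) t := by
  simp [towerMonomial, Prod.fst_prod]

lemma snd_towerMonomial {B₁ B₂ : Type*} [CommRing B₁] [CommRing B₂] {d : ℕ} (x : B₁ × B₂)
    (y : ℕ → B₁ × B₂) (t : ℕ × (Fin d → ℕ)) :
    (towerMonomial x y t).2 = towerMonomial x.2 (fun j => (y j).2) t := by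
  simp [towerMonomial, Prod.snd_prod]

lemma towerMonomial_apply {Z K : Type*} [CommRing K] {d : ℕ} (x : Z → K)
    (y : ℕ → Z → K) (t : ℕ × (Fin d → ℕ)) (z : Z) :
    towerMonomial x y t z = towerMonomial (x z) (fun j => y j z) t := by
  simp [towerMonomial]

/-- A family of points of the Lang covering over a field `K` that are fixed by the twist by `c` of
the `Q`-power Frobenius map. -/
structure IsTwistedFixed {F K : Type*} [CommRing F] [CommRing K] [Algebra F K] (q d Q : ℕ)
    (c : ℕ → F) (x : K) (y : ℕ → K) : Prop extends IsLangTower q d x y where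
  x_pow : x ^ Q = x
  y_pow : ∀ j < d, y (j + 1) ^ Q = towerTwist c y (j + 1)

lemma exists_card_twistedFixed_le (F : Type*) {K : Type*} [Field F] [Fintype F] [Field K]
    [Algebra F K] (d : ℕ) :
    ∃ A : ℕ, ∀ s s' : ℕ, s ≤ s' → A ≤ Fintype.card F ^ s' → ∀ (c : ℕ → F) (Z : Type*) [Fintype Z]
      (xZ : Z → K) (yZ : Z → ℕ → K),
      (∀ z, IsTwistedFixed (Fintype.card F) d (Fintype.card F ^ (s + s')) c (xZ z) (yZ z)) →
      (∀ z z', xZ z = xZ z' → (∀ j < d, yZ z (j + 1) = yZ z' (j + 1)) → z = z') →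
      Fintype.card Z ≤ Fintype.card F ^ (s + s') + A * Fintype.card F ^ s' := by
  set q := Fintype.card F with hqdef
  have hq : 2 ≤ q := Fintype.one_lt_card
  have hq0 : 0 < q := by omega
  obtain ⟨g₀, hg₀⟩ := exists_le_card_reducedExponents_add d hq0
  refine ⟨(g₀ + 1) * (g₀ + 2) + 2 * g₀ + 4, fun s s' hss hA c Z _ xZ yZ hZ hsep => ?_⟩
  obtain ⟨L, _, _, _, V, x, hK, hx⟩ := exists_isAlgClosed_valuation K
  obtain ⟨y, -, h⟩ := exists_isLangTower hq d x
  let _ : Algebra F L := ((algebraMap K L).comp (algebraMap F K)).toAlgebra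
  have hF : ∀ c : F, V.valuation (algebraMap F L c) ≤ 1 := fun c => hK _
  obtain ⟨φ, hφ⟩ := exists_algHom_eq_pow F K s
  obtain ⟨φ', hφ'⟩ := exists_algHom_eq_pow F K (s + s')
  rw [← hqdef] at hφ hφ'
  have hB12 : q ^ s ≤ q ^ s' := pow_le_pow_right₀ hq0 hss
  have hpow : q ^ (s + s') = q ^ s * q ^ s' := pow_add _ _ _
  set B₁ := q ^ s with hB₁
  set B₂ := q ^ s' with hB₂
  set m := B₁ + 2 * g₀ + 2 with hm
  set l := B₂ - 1 with hl
  have hcard : B₁ * l + m + 1 < #(reducedExponents q d m) * #(reducedExponents q d l) := by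
    have h1 := hg₀ m
    have h2 := hg₀ l
    have h5 : B₁ + g₀ + 2 ≤ #(reducedExponents q d m) := by omega
    have h6 : B₂ - 1 - g₀ ≤ #(reducedExponents q d l) := by omega
    refine lt_of_lt_of_le ?_ (Nat.mul_le_mul h5 h6)
    obtain ⟨e, he⟩ : ∃ e, B₂ = e + 1 + g₀ := ⟨B₂ - 1 - g₀, by
      have : g₀ + 1 ≤ B₂ := le_trans (by nlinarith) hA
      omega⟩
    have h3 : B₂ - 1 - g₀ = e := by omega
    have h4 : l = e + g₀ := by omega
    rw [h3, h4, hm]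
    rw [he] at hA hB12
    nlinarith
  have hZ' := fun z => (hZ z).toIsLangTower
  have hB := h.prod_pi hZ'
  obtain ⟨a, ⟨i₀, hi₀⟩, ha⟩ := h.exists_relation V.valuation hq hx hF c hcard
  set X : L × (Z → K) := (x, xZ) with hX
  set Y : ℕ → L × (Z → K) := fun j => (y j, fun z => yZ z j) with hY
  have hrel : ∑ i, a i • (towerMonomial X Y i.2.1 ^ B₁ *
      towerMonomial X (towerTwist c Y) i.1.1) = 0 := by
    refine h.eq_zero_of_fst_eq_zero V.valuation F hq hx hF (sum_mem fun i _ =>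
      Submodule.smul_mem _ _ (hB.towerSpan_mul_mem F hq
        (hB.towerSpan_pow_mem F hq (hB.towerMonomial_mem hq
          (fun j hj => hB.y_mem_towerSpan F hq hj) _) _)
        (hB.towerMonomial_mem hq (fun j hj => hB.towerTwist_mem hq c hj) _))) ?_
    rw [Prod.fst_sum, ← ha]
    refine sum_congr rfl fun i _ => ?_
    rw [Prod.smul_fst, Prod.fst_mul, Prod.pow_fst, fst_towerMonomial, fst_towerMonomial]
    congr 3
    funext j
    simp [towerTwist, Prod.fst_sum, hY]
  set g : L × (Z → K) := ∑ i, algebraMap F K (a i) • towerMonomial X Y (i.2.1 + B₂ • i.1.1)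
    with hg
  have hgmem : g ∈ towerSpan K q d X Y := by
    refine sum_mem fun i _ => Submodule.smul_mem _ _ (hB.towerMonomial_mem hq
      (fun j hj => hB.y_mem_towerSpan K hq hj) _)
  have hg1 : g.1 = ∑ i, algebraMap F K (a i) • towerMonomial x y (i.2.1 + B₂ • i.1.1) := by
    rw [hg, Prod.fst_sum]
    refine sum_congr rfl fun i _ => ?_
    rw [Prod.smul_fst, fst_towerMonomial]
  have hg2 : g.2 = 0 := by
    funext z
    refine pow_eq_zero_iff (n := B₁) (by positivity) |>.1 ?_
    rw [← hφ]
    have hrel' : (∑ i, a i • (towerMonomial X Y i.2.1 ^ B₁ *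
      towerMonomial X (towerTwist c Y) i.1.1)).2 z = 0 := by rw [hrel]; rfl
    rw [Prod.snd_sum, Finset.sum_apply] at hrel'
    rw [hg, Prod.snd_sum, Finset.sum_apply, map_sum, ← hrel']
    refine sum_congr rfl fun i _ => ?_
    rw [Prod.smul_snd, Pi.smul_apply, smul_eq_mul, map_mul, AlgHom.commutes, Prod.smul_snd,
      Pi.smul_apply, Algebra.smul_def (a i), hφ, towerMonomial_add, towerMonomial_nsmul,
      Prod.snd_mul,
      Pi.mul_apply, mul_pow, Prod.snd_mul, Pi.mul_apply, Prod.pow_snd, Pi.pow_apply,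
      Prod.pow_snd, Pi.pow_apply, ← pow_mul, mul_comm B₂, ← hpow, ← hφ',
      snd_towerMonomial _ (towerTwist c Y), snd_towerMonomial, snd_towerMonomial,
      towerMonomial_apply, towerMonomial_apply, towerMonomial_apply, map_towerMonomial]
    have hx' : φ' (X.2 z) = X.2 z := by rw [hφ']; exact (hZ z).x_pow
    rw [hx', towerMonomial_congr (y := fun j => φ' ((Y j).2 z))
      (y' := fun j => (towerTwist c Y j).2 z)]
    intro j hj
    rw [hφ']
    refine ((hZ z).y_pow j hj).trans ?_
    simp [towerTwist, Prod.snd_sum, hY]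
  have hval : V.valuation g.1 ^ q ^ d ≤ V.valuation x ^ (l + B₂ * m) := by
    rw [hg1]
    refine valuation_sum_pow_le _ _ _ (by positivity) fun i _ => ?_
    have hi1 := ((mem_reducedExponents hq0).1 i.1.2).2
    have hi2 := ((mem_reducedExponents hq0).1 i.2.2).2
    rw [Algebra.smul_def, map_mul, mul_pow, h.valuation_towerMonomial_pow _ hq hx,
      towerWeight_add, towerWeight_nsmul]
    refine (mul_le_of_le_one_left' (pow_le_one₀ zero_le (hK _))).trans
      (pow_le_pow_right₀ hx.le ?_)
    exact add_le_add hi2 (Nat.mul_le_mul_left _ hi1)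
  have hgne : g.1 ≠ 0 := by
    rw [hg1]
    refine h.valuation_sum_ne_zero _ hq hx hK univ _ (fun i _ j _ hij => ?_) _ (mem_univ i₀)
      (by simpa using hi₀)
    have hi2 := ((mem_reducedExponents hq0).1 i.2.2)
    have hj2 := ((mem_reducedExponents hq0).1 j.2.2)
    have hlB : l < B₂ := Nat.sub_lt (by positivity) one_pos
    simp only [towerWeight_add, towerWeight_nsmul] at hij
    have e1 := congrArg (· % B₂) hij
    simp only [Nat.add_mul_mod_self_left] at e1
    rw [Nat.mod_eq_of_lt (hi2.2.trans_lt hlB), Nat.mod_eq_of_lt (hj2.2.trans_lt hlB)] at e1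
    rw [e1] at hij
    have e2 := Nat.eq_of_mul_eq_mul_left (by positivity) (Nat.add_left_cancel hij)
    exact Prod.ext (Subtype.ext (towerWeight_injOn ((mem_reducedExponents hq0).1 i.1.2).1
      ((mem_reducedExponents hq0).1 j.1.2).1 e2)) (Subtype.ext (towerWeight_injOn hi2.1 hj2.1 e1))
  have := h.card_le_of_vanish V.valuation hZ' hq hx hK hsep hgmem hgne hg2 hval
  refine this.trans ?_
  rw [hpow, hm]
  have h1 : l ≤ B₂ := by omega
  have h2 : (2 * g₀ + 3) * B₂ ≤ ((g₀ + 1) * (g₀ + 2) + 2 * g₀ + 4) * B₂ :=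
    Nat.mul_le_mul_right _ (by nlinarith)
  linarith

end PointBound

section TruncGroup

/-- The group of power series with constant coefficient `1` modulo `X ^ (d + 1)`, written
additively; an element is recorded by its coefficients of `X, …, X ^ d`. -/
def OneUnits (F : Type*) (d : ℕ) : Type _ := Fin d → F

noncomputable instance (F : Type*) [Fintype F] (d : ℕ) : Fintype (OneUnits F d) :=
  inferInstanceAs (Fintype (Fin d → F))

namespace OneUnits

lemma card_eq {F : Type*} [Fintype F] {d : ℕ} :
    Fintype.card (OneUnits F d) = Fintype.card F ^ d := by
  have : Fintype.card (OneUnits F d) = Fintype.card (Fin d → F) := Fintype.card_congr (Equiv.refl _)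
  rw [this]; simp

variable {F : Type*} [Field F] {d : ℕ}

/-- The coefficient of `X ^ n` of the polynomial representing an element. -/
noncomputable def coeff (a : OneUnits F d) (n : ℕ) : F :=
  if n = 0 then 1 else if h : n - 1 < d then a ⟨n - 1, h⟩ else 0

/-- The class of a power series. -/
noncomputable def ofSeries (d : ℕ) (s : PowerSeries F) : OneUnits F d :=
  fun j => PowerSeries.coeff (j + 1) s

/-- The polynomial representing an element, as a power series. -/
noncomputable def toSeries (a : OneUnits F d) : PowerSeries F := PowerSeries.mk a.coeff

@[simp] lemma coeff_zero (a : OneUnits F d) : a.coeff 0 = 1 := by simp [coeff]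

lemma coeff_succ (a : OneUnits F d) (j : Fin d) : a.coeff (j + 1) = a j := by simp [coeff]

lemma coeff_ofSeries {s : PowerSeries F} (hs : PowerSeries.constantCoeff s = 1) {n : ℕ}
    (hn : n ≤ d) : (ofSeries d s).coeff n = PowerSeries.coeff n s := by
  rcases n with _ | n
  · simp [hs]
  · exact coeff_succ (ofSeries d s) ⟨n, hn⟩

@[simp] lemma constantCoeff_toSeries (a : OneUnits F d) :
    PowerSeries.constantCoeff a.toSeries = 1 := by
  rw [← PowerSeries.coeff_zero_eq_constantCoeff_apply, toSeries, PowerSeries.coeff_mk, coeff_zero]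

@[simp] lemma ofSeries_toSeries (a : OneUnits F d) : ofSeries d a.toSeries = a := by
  funext j
  simp [ofSeries, toSeries, coeff_succ]

lemma ofSeries_toSeries_mul {s : PowerSeries F} (hs : PowerSeries.constantCoeff s = 1)
    (t : PowerSeries F) : ofSeries d ((ofSeries d s).toSeries * t) = ofSeries d (s * t) := by
  funext j
  simp only [ofSeries, PowerSeries.coeff_mul]
  refine sum_congr rfl fun ij hij => ?_
  rw [HasAntidiagonal.mem_antidiagonal] at hij
  congr 1
  rw [toSeries, PowerSeries.coeff_mk]
  exact coeff_ofSeries hs (by have := j.2; omega)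

noncomputable instance : AddCommMagma (OneUnits F d) where
  add a b := ofSeries d (a.toSeries * b.toSeries)
  add_comm a b := congrArg (ofSeries d) (mul_comm a.toSeries b.toSeries)

lemma add_def (a b : OneUnits F d) : a + b = ofSeries d (a.toSeries * b.toSeries) := rfl

lemma ofSeries_mul {s t : PowerSeries F} (hs : PowerSeries.constantCoeff s = 1)
    (ht : PowerSeries.constantCoeff t = 1) :
    ofSeries d (s * t) = ofSeries d s + ofSeries d t := by
  rw [add_def, ofSeries_toSeries_mul hs, mul_comm, mul_comm s, ofSeries_toSeries_mul ht]

noncomputable instance : Zero (OneUnits F d) := ⟨ofSeries d 1⟩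

noncomputable instance : Neg (OneUnits F d) := ⟨fun a => ofSeries d a.toSeries⁻¹⟩

noncomputable instance : AddCommGroup (OneUnits F d) where
  add_assoc a b c := by
    change ofSeries d ((ofSeries d (a.toSeries * b.toSeries)).toSeries * c.toSeries) =
      ofSeries d (a.toSeries * (ofSeries d (b.toSeries * c.toSeries)).toSeries)
    rw [ofSeries_toSeries_mul (by simp), mul_comm a.toSeries (toSeries (ofSeries d _)),
      ofSeries_toSeries_mul (by simp)]
    congr 1; ring
  zero_add a := by
    change ofSeries d ((ofSeries d 1).toSeries * a.toSeries) = a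
    rw [ofSeries_toSeries_mul (by simp), one_mul, ofSeries_toSeries]
  add_zero a := by
    change ofSeries d (a.toSeries * (ofSeries d 1).toSeries) = a
    rw [mul_comm, ofSeries_toSeries_mul (by simp), one_mul, ofSeries_toSeries]
  nsmul := nsmulRec
  zsmul := zsmulRec
  neg_add_cancel a := by
    change ofSeries d ((ofSeries d a.toSeries⁻¹).toSeries * a.toSeries) = ofSeries d 1
    rw [ofSeries_toSeries_mul (by simp), PowerSeries.inv_mul_cancel _ (by simp)]
  add_comm a b := add_comm a b

/-- The class of the reciprocal polynomial of a monic polynomial. -/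
noncomputable def ofPoly (d : ℕ) (f : Polynomial F) : OneUnits F d :=
  ofSeries d (f.reverse : PowerSeries F)

lemma ofPoly_mul {f g : Polynomial F} (hf : f.Monic) (hg : g.Monic) :
    ofPoly d (f * g) = ofPoly d f + ofPoly d g := by
  have h : ∀ {f : Polynomial F}, f.Monic →
      PowerSeries.constantCoeff (f.reverse : PowerSeries F) = 1 := fun {f} hf => by
    rw [← PowerSeries.coeff_zero_eq_constantCoeff_apply, Polynomial.coeff_coe,
      Polynomial.coeff_zero_reverse, hf]
  rw [ofPoly, Polynomial.reverse_mul_of_domain, Polynomial.coe_mul, ofSeries_mul (h hf) (h hg)]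
  rfl

lemma coeff_ofPoly {f : Polynomial F} (hf : f.Monic) {n : ℕ} (hn : n ≤ d) :
    (ofPoly d f).coeff n = f.reverse.coeff n := by
  rw [ofPoly, coeff_ofSeries _ hn, Polynomial.coeff_coe]
  rw [← PowerSeries.coeff_zero_eq_constantCoeff_apply, Polynomial.coeff_coe,
      Polynomial.coeff_zero_reverse, hf]

lemma ext_coeff {a b : OneUnits F d} (h : ∀ n, 1 ≤ n → n ≤ d → a.coeff n = b.coeff n) :
    a = b := by
  funext j
  have := h (j + 1) (by omega) j.2
  rwa [coeff_succ, coeff_succ] at this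

end OneUnits

end TruncGroup

section Mangoldt

open Polynomial

variable {F : Type*} [Field F]

lemma polyVonMangoldt_pow {p : F[X]} (hp : Irreducible p) {k : ℕ} (hk : 1 ≤ k) :
    polyVonMangoldt (p ^ k) = p.natDegree := by
  have h : ∃ g : F[X], Irreducible g ∧ ∃ l : ℕ, 1 ≤ l ∧ p ^ k = g ^ l := ⟨p, hp, k, hk, rfl⟩
  rw [polyVonMangoldt, dif_pos h]
  obtain ⟨hg, l, hl, he⟩ := h.choose_spec
  refine natDegree_eq_of_degree_eq (degree_eq_degree_of_associated ?_)
  refine hg.associated_of_dvd hp (hg.prime.dvd_of_dvd_pow (n := k) ?_)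
  exact (dvd_pow_self _ (by omega)).trans he.symm.dvd

lemma exists_monic_eq_pow {f : F[X]} (hf : f.Monic) (h : polyVonMangoldt f ≠ 0) :
    ∃ p : F[X], p.Monic ∧ Irreducible p ∧ ∃ k : ℕ, 1 ≤ k ∧ f = p ^ k := by
  rw [polyVonMangoldt] at h
  split_ifs at h with hex
  · obtain ⟨g, hg, k, hk, rfl⟩ := hex
    refine ⟨g * C g.leadingCoeff⁻¹, monic_mul_leadingCoeff_inv hg.ne_zero,
      irreducible_mul_leadingCoeff_inv.2 hg, k, hk, ?_⟩
    have : g.leadingCoeff ^ k = 1 := by rw [← leadingCoeff_pow]; exact hf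
    rw [mul_pow, ← C_pow, inv_pow, this]
    simp
  · exact absurd rfl h

variable [Fintype F]

/-- The monic polynomials of degree `r`. -/
noncomputable def monicPolys (F : Type*) [Field F] [Fintype F] (r : ℕ) : Finset F[X] :=
  univ.image (monicOfCoeffs (F := F) r)

lemma coeff_monicOfCoeffs {F : Type*} [Field F] (n : ℕ) (c : Fin n → F) (i : Fin n) :
    (monicOfCoeffs n c).coeff i = c i := by
  rw [monicOfCoeffs, coeff_add, coeff_X_pow, if_neg i.2.ne, finsetSum_coeff, sum_eq_single i]
  · simp
  · intro j _ hj
    rw [coeff_C_mul_X_pow, if_neg fun h => hj (Fin.ext h.symm)]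
  · simp

lemma monic_monicOfCoeffs {F : Type*} [Field F] (n : ℕ) (c : Fin n → F) :
    (monicOfCoeffs n c).Monic :=
  monic_X_pow_add (degree_sum_fin_lt c)

lemma natDegree_monicOfCoeffs {F : Type*} [Field F] (n : ℕ) (c : Fin n → F) :
    (monicOfCoeffs n c).natDegree = n := by
  rw [monicOfCoeffs, natDegree_eq_of_degree_eq
    (degree_add_eq_left_of_degree_lt (by rw [degree_X_pow]; exact degree_sum_fin_lt c)),
    natDegree_X_pow]

lemma monicOfCoeffs_injective (F : Type*) [Field F] (n : ℕ) :
    Function.Injective (monicOfCoeffs (F := F) n) := fun c c' h => by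
  funext i
  rw [← coeff_monicOfCoeffs n c, h, coeff_monicOfCoeffs]

lemma monicOfCoeffs_coeff {F : Type*} [Field F] {f : F[X]} (hf : f.Monic) {n : ℕ}
    (hn : f.natDegree = n) : monicOfCoeffs n (fun i : Fin n => f.coeff i) = f := by
  rw [monicOfCoeffs, Fin.sum_univ_eq_sum_range (fun i => C (f.coeff i) * X ^ i), ← hn]
  exact hf.as_sum.symm

lemma mem_monicPolys {r : ℕ} {f : F[X]} : f ∈ monicPolys F r ↔ f.Monic ∧ f.natDegree = r := by
  rw [monicPolys, mem_image]
  constructor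
  · rintro ⟨c, -, rfl⟩
    exact ⟨monic_monicOfCoeffs r c, natDegree_monicOfCoeffs r c⟩
  · rintro ⟨hf, hr⟩
    exact ⟨_, mem_univ _, monicOfCoeffs_coeff hf hr⟩

lemma sum_monicPolys {M : Type*} [AddCommMonoid M] (r : ℕ) (φ : F[X] → M) :
    ∑ f ∈ monicPolys F r, φ f = ∑ c : Fin r → F, φ (monicOfCoeffs r c) := by
  rw [monicPolys, sum_image fun _ _ _ _ h => monicOfCoeffs_injective F r h]

/-- The monic divisors of a polynomial. -/
noncomputable def monicDivisors (f : F[X]) : Finset F[X] :=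
  ((range (f.natDegree + 1)).biUnion (monicPolys F)).filter (· ∣ f)

lemma mem_monicDivisors {f g : F[X]} (hf : f ≠ 0) : g ∈ monicDivisors f ↔ g.Monic ∧ g ∣ f := by
  simp only [monicDivisors, mem_filter, mem_biUnion, mem_range, mem_monicPolys]
  constructor
  · rintro ⟨⟨i, hi, hg, -⟩, h⟩
    exact ⟨hg, h⟩
  · rintro ⟨hg, h⟩
    exact ⟨⟨_, Nat.lt_succ_of_le (natDegree_le_of_dvd h hf), hg, rfl⟩, h⟩

lemma sum_monicDivisors_mul {p h : F[X]} (hp : p.Monic) (hpi : Irreducible p) (hh : h.Monic) :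
    ∑ g ∈ monicDivisors (p * h), polyVonMangoldt g =
      p.natDegree + ∑ g ∈ monicDivisors h, polyVonMangoldt g := by
  have hph := (hp.mul hh).ne_zero
  have hsub : monicDivisors h ⊆ monicDivisors (p * h) := fun g hg => by
    rw [mem_monicDivisors hh.ne_zero] at hg
    exact (mem_monicDivisors hph).2 ⟨hg.1, hg.2.mul_left p⟩
  rw [← sum_sdiff hsub]
  congr 1
  have hfin : FiniteMultiplicity p h := FiniteMultiplicity.of_prime_left hpi.prime hh.ne_zero
  set e := multiplicity p h
  rw [sum_eq_single (p ^ (e + 1)), polyVonMangoldt_pow hpi (by omega)]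
  · intro g hg hne
    rw [mem_sdiff, mem_monicDivisors hph, mem_monicDivisors hh.ne_zero] at hg
    by_contra h0
    obtain ⟨P, hP, hPi, k, hk, rfl⟩ := exists_monic_eq_pow hg.1.1 h0
    have hnd : ¬ P ^ k ∣ h := fun hd => hg.2 ⟨hg.1.1, hd⟩
    by_cases hPp : P = p
    · subst hPp
      obtain ⟨k, rfl⟩ : ∃ l, k = l + 1 := ⟨k - 1, by omega⟩
      have h1 : P ^ k ∣ h := by
        have := hg.1.2
        rw [pow_succ'] at this
        exact (mul_dvd_mul_iff_left hPi.ne_zero).1 this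
      have h2 := hfin.pow_dvd_iff_le_multiplicity.1 h1
      have h3 : ¬ k + 1 ≤ e := fun hle => hnd (hfin.pow_dvd_iff_le_multiplicity.2 hle)
      exact hne (by congr 1; omega)
    · refine hnd (IsCoprime.dvd_of_dvd_mul_left ?_ hg.1.2)
      refine IsCoprime.pow_left ((hPi.coprime_iff_not_dvd).2 fun hd => hPp ?_)
      exact eq_of_monic_of_associated hP hp (hPi.associated_of_dvd hpi hd)
  · intro hne
    refine absurd ?_ hne
    rw [mem_sdiff, mem_monicDivisors hph, mem_monicDivisors hh.ne_zero]
    refine ⟨⟨hp.pow _, ?_⟩, fun hd => ?_⟩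
    · rw [pow_succ']
      exact mul_dvd_mul_left p (pow_multiplicity_dvd p h)
    · have := hfin.pow_dvd_iff_le_multiplicity.1 hd.2
      omega

lemma sum_monicDivisors_polyVonMangoldt {f : F[X]} (hf : f.Monic) :
    ∑ g ∈ monicDivisors f, polyVonMangoldt g = f.natDegree := by
  induction hn : f.natDegree using Nat.strong_induction_on generalizing f with
  | _ n ih =>
    by_cases hu : IsUnit f
    · rw [hf.isUnit_iff.1 hu] at hn ⊢
      rw [← hn, natDegree_one]
      refine sum_eq_zero fun g hg => ?_
      rw [mem_monicDivisors one_ne_zero] at hg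
      by_contra h0
      obtain ⟨p, hp, hpi, k, hk, rfl⟩ := exists_monic_eq_pow hg.1 h0
      exact hpi.not_isUnit (isUnit_of_dvd_one ((dvd_pow_self p (by omega)).trans hg.2))
    · obtain ⟨p, hp, hpi, h, rfl⟩ := exists_monic_irreducible_factor f hu
      have hh : h.Monic := hp.of_mul_monic_left hf
      have hdeg : (p * h).natDegree = p.natDegree + h.natDegree := hp.natDegree_mul hh
      have := hpi.natDegree_pos
      rw [sum_monicDivisors_mul hp hpi hh, ih h.natDegree (by omega) hh rfl, ← hdeg, hn]

lemma sum_antidiagonal_polyVonMangoldt {R : Type*} [CommRing R] (r : ℕ) (φ : F[X] → R) :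
    ∑ ij ∈ antidiagonal r, ∑ g ∈ monicPolys F ij.1, ∑ h ∈ monicPolys F ij.2,
      (polyVonMangoldt g : R) * φ (g * h) = r * ∑ f ∈ monicPolys F r, φ f := by
  have h1 : (r : R) * ∑ f ∈ monicPolys F r, φ f =
      ∑ f ∈ monicPolys F r, ∑ g ∈ monicDivisors f, (polyVonMangoldt g : R) * φ f := by
    rw [mul_sum]
    refine sum_congr rfl fun f hf => ?_
    rw [mem_monicPolys] at hf
    rw [← sum_mul, ← Nat.cast_sum, sum_monicDivisors_polyVonMangoldt hf.1, hf.2]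
  rw [h1]
  have h2 : ∀ ij : ℕ × ℕ, ∑ g ∈ monicPolys F ij.1, ∑ h ∈ monicPolys F ij.2,
      (polyVonMangoldt g : R) * φ (g * h) = ∑ t ∈ monicPolys F ij.1 ×ˢ monicPolys F ij.2,
      (polyVonMangoldt t.1 : R) * φ (t.1 * t.2) := fun ij => by rw [sum_product]
  simp only [h2]
  rw [sum_sigma', sum_sigma']
  refine sum_nbij' (fun t => ⟨t.2.1 * t.2.2, t.2.1⟩)
    (fun t => ⟨(t.2.natDegree, (t.1 / t.2).natDegree), (t.2, t.1 / t.2)⟩) ?_ ?_ ?_ ?_ ?_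
  · rintro ⟨⟨i, j⟩, ⟨g, h⟩⟩ ht
    simp only [mem_sigma, HasAntidiagonal.mem_antidiagonal, mem_product, mem_monicPolys] at ht ⊢
    obtain ⟨hr, ⟨hg, hgi⟩, ⟨hh, hhj⟩⟩ := ht
    refine ⟨⟨hg.mul hh, by rw [hg.natDegree_mul hh]; omega⟩, ?_⟩
    rw [mem_monicDivisors (hg.mul hh).ne_zero]
    exact ⟨hg, dvd_mul_right _ _⟩
  · rintro ⟨f, g⟩ ht
    simp only [mem_sigma, HasAntidiagonal.mem_antidiagonal, mem_product, mem_monicPolys] at ht ⊢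
    obtain ⟨⟨hf, hr⟩, hg⟩ := ht
    rw [mem_monicDivisors hf.ne_zero] at hg
    obtain ⟨hg, h, rfl⟩ := hg
    have hh : h.Monic := hg.of_mul_monic_left hf
    rw [mul_div_cancel_left₀ _ hg.ne_zero, ← hr, hg.natDegree_mul hh]
    exact ⟨rfl, ⟨hg, trivial⟩, hh, trivial⟩
  · rintro ⟨⟨i, j⟩, ⟨g, h⟩⟩ ht
    simp only [mem_sigma, HasAntidiagonal.mem_antidiagonal, mem_product, mem_monicPolys] at ht ⊢
    obtain ⟨hr, ⟨hg, rfl⟩, ⟨hh, rfl⟩⟩ := ht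
    rw [mul_div_cancel_left₀ _ hg.ne_zero]
  · rintro ⟨f, g⟩ ht
    simp only [mem_sigma, mem_monicPolys] at ht ⊢
    obtain ⟨⟨hf, hr⟩, hg⟩ := ht
    rw [mem_monicDivisors hf.ne_zero] at hg
    obtain ⟨hg, h, rfl⟩ := hg
    rw [mul_div_cancel_left₀ _ hg.ne_zero]
  · rintro ⟨⟨i, j⟩, ⟨g, h⟩⟩ _
    rfl

end Mangoldt

section CharacterSums

open Polynomial

variable {F : Type*} [Field F]

lemma ofPoly_monicOfCoeffs_append {k d : ℕ} (a : Fin k → F) (b : Fin d → F) :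
    OneUnits.ofPoly d (monicOfCoeffs (k + d) (Fin.append a b)) = fun j => b (Fin.rev j) := by
  funext j
  have hj := j.2
  rw [OneUnits.ofPoly, OneUnits.ofSeries, Polynomial.coeff_coe, coeff_reverse,
    natDegree_monicOfCoeffs, revAt_le (by omega)]
  have : k + d - (j + 1) = (Fin.natAdd k (Fin.rev j) : Fin (k + d)) := by
    rw [Fin.val_natAdd, Fin.val_rev]; omega
  rw [this, coeff_monicOfCoeffs, Fin.append_right]

variable [Fintype F]

omit [Field F] in
lemma sum_oneUnits_rev {M : Type*} [AddCommMonoid M] {d : ℕ} (φ : OneUnits F d → M) :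
    ∑ b : Fin d → F, φ (fun j => b (Fin.rev j)) = ∑ v : OneUnits F d, φ v :=
  Fintype.sum_equiv (Equiv.arrowCongr Fin.revPerm (Equiv.refl F)) _ _ fun _ => rfl

lemma sum_ofPoly {R : Type*} [CommSemiring R] {k d : ℕ} (φ : OneUnits F d → R) :
    ∑ c : Fin (k + d) → F, φ (OneUnits.ofPoly d (monicOfCoeffs (k + d) c)) =
      (Fintype.card F : R) ^ k * ∑ v, φ v := by
  rw [← (Fin.appendEquiv k d).sum_comp, Fintype.sum_prod_type]
  simp only [Fin.appendEquiv, Equiv.coe_fn_mk, ofPoly_monicOfCoeffs_append, sum_oneUnits_rev,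
    sum_const, card_univ, Fintype.card_pi, prod_const, Fintype.card_fin, nsmul_eq_mul, Nat.cast_pow]

/-- The sum of the von Mangoldt function over monic polynomials of degree `r` with prescribed
leading coefficients. -/
noncomputable def mangoldtCount (r : ℕ) {d : ℕ} (v : OneUnits F d) : ℕ :=
  ∑ f ∈ monicPolys F r with OneUnits.ofPoly d f = v, polyVonMangoldt f

lemma sum_mangoldtCount_mul {R : Type*} [CommSemiring R] (r : ℕ) {d : ℕ}
    (φ : OneUnits F d → R) : ∑ v, (mangoldtCount r v : R) * φ v =
      ∑ f ∈ monicPolys F r, (polyVonMangoldt f : R) * φ (OneUnits.ofPoly d f) := by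
  rw [← sum_fiberwise (monicPolys F r) (OneUnits.ofPoly d)]
  refine sum_congr rfl fun v _ => ?_
  rw [mangoldtCount, Nat.cast_sum, sum_mul]
  refine sum_congr rfl fun f hf => ?_
  rw [(mem_filter.1 hf).2]

lemma mangoldtCount_ofPoly {k d : ℕ} (a : Fin k → F) (b : Fin d → F) :
    mangoldtCount (k + d) (OneUnits.ofPoly d (monicOfCoeffs (k + d) (Fin.append a b))) =
      ∑ a' : Fin k → F, polyVonMangoldt (monicOfCoeffs (k + d) (Fin.append a' b)) := by
  rw [mangoldtCount, sum_filter, sum_monicPolys, ← (Fin.appendEquiv k d).sum_comp,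
    Fintype.sum_prod_type]
  refine sum_congr rfl fun a' _ => ?_
  rw [sum_eq_single b]
  · exact if_pos (by simp only [Fin.appendEquiv, Equiv.coe_fn_mk, ofPoly_monicOfCoeffs_append]; rfl)
  · intro b' _ hb
    refine if_neg fun h => hb ?_
    simp only [Fin.appendEquiv, Equiv.coe_fn_mk, ofPoly_monicOfCoeffs_append] at h
    funext j
    simpa using congrFun h (Fin.rev j)
  · simp

lemma card_monicPolys (r : ℕ) : #(monicPolys F r) = Fintype.card F ^ r := by
  rw [card_eq_sum_ones, sum_monicPolys]; simp

lemma monicPolys_zero : monicPolys F 0 = {1} := by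
  ext f
  rw [mem_monicPolys, mem_singleton]
  exact ⟨fun h => h.1.natDegree_eq_zero.1 h.2, fun h => by subst h; simp [monic_one]⟩

omit [Fintype F] in
lemma polyVonMangoldt_one : polyVonMangoldt (1 : F[X]) = 0 := by
  by_contra h0
  obtain ⟨p, hp, hpi, k, hk, h⟩ := exists_monic_eq_pow monic_one h0
  exact hpi.not_isUnit (isUnit_of_dvd_one ((dvd_pow_self p (by omega)).trans h.symm.dvd))

/-- The sum of a character over the classes of monic polynomials of degree `r`. -/
noncomputable def charSum {d : ℕ} (χ : AddChar (OneUnits F d) ℂ) (r : ℕ) : ℂ :=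
  ∑ f ∈ monicPolys F r, χ (OneUnits.ofPoly d f)

/-- The sum of a character over the classes of monic polynomials of degree `r`, weighted by the
von Mangoldt function. -/
noncomputable def mangoldtSum {d : ℕ} (χ : AddChar (OneUnits F d) ℂ) (r : ℕ) : ℂ :=
  ∑ v, (mangoldtCount r v : ℂ) * χ v

lemma sum_antidiagonal_mangoldtSum_mul_charSum {d : ℕ} (χ : AddChar (OneUnits F d) ℂ) (r : ℕ) :
    ∑ ij ∈ antidiagonal r, mangoldtSum χ ij.1 * charSum χ ij.2 = r * charSum χ r := by
  rw [charSum, ← sum_antidiagonal_polyVonMangoldt]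
  refine sum_congr rfl fun ij _ => ?_
  rw [mangoldtSum, sum_mangoldtCount_mul, charSum, sum_mul_sum]
  refine sum_congr rfl fun g hg => sum_congr rfl fun h hh => ?_
  rw [OneUnits.ofPoly_mul (mem_monicPolys.1 hg).1 (mem_monicPolys.1 hh).1, AddChar.map_add_eq_mul]
  ring

lemma charSum_zero {d : ℕ} (χ : AddChar (OneUnits F d) ℂ) : charSum χ 0 = 1 := by
  have h : OneUnits.ofPoly d (1 : F[X]) = 0 := by
    rw [OneUnits.ofPoly, ← C_1, reverse_C, C_1, Polynomial.coe_one]; rfl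
  rw [charSum, monicPolys_zero, sum_singleton, h, AddChar.map_zero_eq_one]

lemma mangoldtSum_zero {d : ℕ} (χ : AddChar (OneUnits F d) ℂ) : mangoldtSum χ 0 = 0 := by
  rw [mangoldtSum, sum_mangoldtCount_mul, monicPolys_zero, sum_singleton, polyVonMangoldt_one]
  simp

lemma charSum_eq_zero {d : ℕ} {χ : AddChar (OneUnits F d) ℂ} (hχ : χ ≠ 0) {r : ℕ} (hr : d ≤ r) :
    charSum χ r = 0 := by
  obtain ⟨k, rfl⟩ := Nat.exists_eq_add_of_le' hr
  rw [charSum, sum_monicPolys, sum_ofPoly, AddChar.sum_eq_ite, if_neg hχ, mul_zero]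

lemma sum_polyVonMangoldt {r : ℕ} (hr : 1 ≤ r) :
    ∑ f ∈ monicPolys F r, polyVonMangoldt f = Fintype.card F ^ r := by
  have h : ∀ r : ℕ, ∑ ij ∈ antidiagonal r, (∑ f ∈ monicPolys F ij.1, (polyVonMangoldt f : ℤ)) *
      (Fintype.card F : ℤ) ^ ij.2 = r * (Fintype.card F : ℤ) ^ r := fun r => by
    have := sum_antidiagonal_polyVonMangoldt (F := F) r (fun _ => (1 : ℤ))
    simp only [mul_one, sum_const, card_monicPolys, nsmul_eq_mul, Nat.cast_pow] at this
    rw [← this]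
    refine sum_congr rfl fun ij _ => ?_
    rw [sum_mul]
    exact sum_congr rfl fun _ _ => mul_comm _ _
  obtain ⟨r, rfl⟩ : ∃ s, r = s + 1 := ⟨r - 1, by omega⟩
  have h1 := h (r + 1)
  rw [Nat.sum_antidiagonal_succ'] at h1
  have h2 : ∑ ij ∈ antidiagonal r, (∑ f ∈ monicPolys F ij.1, (polyVonMangoldt f : ℤ)) *
      (Fintype.card F : ℤ) ^ (ij.2 + 1) = r * (Fintype.card F : ℤ) ^ (r + 1) := by
    rw [pow_succ (Fintype.card F : ℤ) r, ← mul_assoc, ← h r, sum_mul]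
    exact sum_congr rfl fun _ _ => by ring
  rw [h2] at h1
  push_cast at h1
  zify
  linarith

lemma sum_mangoldtCount {r d : ℕ} (hr : 1 ≤ r) :
    ∑ v : OneUnits F d, mangoldtCount r v = Fintype.card F ^ r := by
  rw [← sum_polyVonMangoldt hr]
  simpa using sum_mangoldtCount_mul (F := F) (R := ℕ) r (d := d) (fun _ => 1)

lemma mangoldtCount_le {r d : ℕ} (hr : 1 ≤ r) (v : OneUnits F d) :
    mangoldtCount r v ≤ Fintype.card F ^ r := by
  rw [← sum_mangoldtCount (d := d) hr]
  exact single_le_sum (f := fun v : OneUnits F d => mangoldtCount r v) (fun _ _ => Nat.zero_le _)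
    (mem_univ v)

end CharacterSums

section RootsOfPrimePowers

open Polynomial

variable {F K : Type*} [Field F] [Fintype F] [Field K] [Algebra F K]

lemma mem_range_algebraMap_of_pow_card {x : K} (hx : x ^ Fintype.card F = x) :
    x ∈ Set.range (algebraMap F K) := by
  by_contra h
  have hne : (X ^ Fintype.card F - X : K[X]) ≠ 0 :=
    FiniteField.X_pow_card_sub_X_ne_zero _ Fintype.one_lt_card
  have h1 : #(insert x (univ.image (algebraMap F K))) ≤
      (X ^ Fintype.card F - X : K[X]).natDegree := by
    refine card_le_degree_of_subset_roots fun y hy => ?_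
    rw [mem_val, mem_insert, mem_image] at hy
    rw [mem_roots hne]
    rcases hy with rfl | ⟨a, -, rfl⟩
    · simp [hx]
    · simp [← map_pow, FiniteField.pow_card]
  rw [FiniteField.X_pow_card_sub_X_natDegree_eq _ Fintype.one_lt_card, card_insert_of_notMem
    (by simpa using h), card_image_of_injective _ (algebraMap F K).injective, card_univ] at h1
  omega

lemma pow_card_pow_of_aeval_eq_zero {p : F[X]} (hp : Irreducible p) {x : K}
    (hx : aeval x p = 0) {r : ℕ} (hr : p.natDegree ∣ r) : x ^ Fintype.card F ^ r = x := by
  have h := hp.natDegree_dvd_iff_dvd_X_pow_card_pow_sub_X.1 hr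
  have := aeval_eq_zero_of_dvd_aeval_eq_zero h hx
  rw [Nat.card_eq_fintype_card] at this
  simpa [sub_eq_zero] using this

lemma prod_X_sub_pow_card {p : F[X]} (hpm : p.Monic) (hp : Irreducible p) {x : K}
    (hx : aeval x p = 0) :
    ∏ i ∈ range p.natDegree, (X - C (x ^ Fintype.card F ^ i)) = p.map (algebraMap F K) := by
  set q := Fintype.card F with hq
  set P : K[X] := ∏ i ∈ range p.natDegree, (X - C (x ^ q ^ i)) with hP
  have hmon : P.Monic := monic_prod_of_monic _ _ fun i _ => monic_X_sub_C _
  have hdeg : P.natDegree = p.natDegree := by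
    rw [hP, natDegree_prod_of_monic _ _ fun i _ => monic_X_sub_C _]
    simp only [natDegree_X_sub_C, sum_const, card_range, smul_eq_mul, mul_one]
  have hpos := hp.natDegree_pos
  obtain ⟨φ, hφ⟩ := exists_algHom_eq_pow F K 1
  have hfix : P.map (φ : K →+* K) = P := by
    obtain ⟨e, he⟩ : ∃ e, p.natDegree = e + 1 := ⟨p.natDegree - 1, by omega⟩
    rw [hP, Polynomial.map_prod, he, prod_range_succ, prod_range_succ', mul_comm]
    simp only [Polynomial.map_sub, map_X, map_C, RingHom.coe_coe, hφ, ← hq, pow_one, ← pow_mul,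
      ← pow_succ, pow_zero]
    rw [mul_comm, ← he, pow_card_pow_of_aeval_eq_zero hp hx dvd_rfl]
  have hlift : P ∈ lifts (algebraMap F K) := by
    rw [lifts_iff_coeff_lifts]
    intro n
    refine mem_range_algebraMap_of_pow_card ?_
    have := congrArg (fun f => f.coeff n) hfix
    simpa [hφ] using this
  obtain ⟨g, hg, hgdeg, hgm⟩ := lifts_and_natDegree_eq_and_monic hlift hmon
  have hgx : aeval x g = 0 := by
    rw [aeval_def, ← eval_map, hg, hP, eval_prod]
    exact prod_eq_zero (mem_range.2 hpos) (by simp)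
  have hdvd : p ∣ g := (hp.dvd_iff_aeval_eq_zero hx).1 hgx
  rw [← hg, eq_of_monic_of_dvd_of_natDegree_le hpm hgm hdvd (by omega)]

lemma prod_X_sub_pow_card_of_dvd {p : F[X]} (hpm : p.Monic) (hp : Irreducible p) {x : K}
    (hx : aeval x p = 0) (k : ℕ) :
    ∏ i ∈ range (p.natDegree * k), (X - C (x ^ Fintype.card F ^ i)) =
      (p ^ k).map (algebraMap F K) := by
  induction k with
  | zero => simp
  | succ k ih =>
    rw [mul_add, mul_one, prod_range_add, ih, pow_succ, Polynomial.map_mul,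
      ← prod_X_sub_pow_card hpm hp hx]
    congr 1
    refine prod_congr rfl fun i _ => ?_
    rw [pow_add, pow_mul, pow_card_pow_of_aeval_eq_zero hp hx (dvd_mul_right _ _)]

lemma coe_reverse_prod_X_sub (r : ℕ) (a : ℕ → K) :
    ((∏ i ∈ range r, (X - C (a i))).reverse : PowerSeries K) =
      ∏ i ∈ range r, (1 - PowerSeries.C (a i) * PowerSeries.X) := by
  induction r with
  | zero => rw [prod_range_zero, prod_range_zero, ← C_1, reverse_C, C_1, Polynomial.coe_one]
  | succ r ih =>
    have : (X - C (a r)).reverse = 1 - C (a r) * X := by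
      rw [sub_eq_add_neg, ← C_neg, reverse_add_C]
      have h1 : (X : K[X]).reverse = 1 := by
        rw [← mul_one X, reverse_X_mul, ← C_1, reverse_C]
      simp [sub_eq_add_neg, h1]
    rw [prod_range_succ, prod_range_succ, reverse_mul_of_domain, Polynomial.coe_mul, ih, this]
    simp

/-- The number of distinct roots of a prime power is its von Mangoldt value. -/
lemma card_roots_of_prime_power [IsAlgClosed K] {p : F[X]} (hp : Irreducible p)
    {k : ℕ} (hk : 1 ≤ k) :
    #((p ^ k).map (algebraMap F K)).roots.toFinset = polyVonMangoldt (p ^ k) := by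
  rw [polyVonMangoldt_pow hp hk, Polynomial.map_pow, roots_pow,
    Multiset.toFinset_nsmul _ _ (by omega),
    ← card_rootSet_eq_natDegree (K := K) (PerfectField.separable_of_irreducible hp)
      (IsAlgClosed.splits _)]
  simp [rootSet_def, aroots_def]

omit [Fintype F] in
lemma reverse_map_of_injective (f : F[X]) :
    (f.map (algebraMap F K)).reverse = f.reverse.map (algebraMap F K) := by
  ext n
  rw [coeff_map, coeff_reverse, coeff_reverse, coeff_map, natDegree_map]

end RootsOfPrimePowers

section PointCount

variable {F K : Type*} [Field F] [Fintype F] [Field K] [Algebra F K]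

lemma towerTwist_pow_card {x : K} {y : ℕ → K} (hy0 : y 0 = 1)
    (hy : ∀ j, y (j + 1) ^ Fintype.card F = y (j + 1) - x * y j) (c : ℕ → F) (j : ℕ) :
    towerTwist c y (j + 1) ^ Fintype.card F =
      towerTwist c y (j + 1) - x * towerTwist c y j := by
  have hφ : ∀ a, FiniteField.frobeniusAlgHom F K a = a ^ Fintype.card F := fun _ => rfl
  rw [← hφ]
  simp only [towerTwist, map_sum, map_smul]
  rw [sum_range_succ', sum_range_succ' (fun i => c (j + 1 - i) • y i), mul_sum, add_sub_right_comm,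
    ← sum_sub_distrib]
  congr 1
  · refine sum_congr rfl fun i _ => ?_
    rw [hφ, hy, Nat.add_sub_add_right, smul_sub, mul_smul_comm]
  · rw [hy0, map_one]

omit [Fintype F] in
lemma towerTwist_zero {y : ℕ → K} (hy0 : y 0 = 1) {c : ℕ → F} (hc : c 0 = 1) :
    towerTwist c y 0 = 1 := by simp [towerTwist, hy0, hc]

omit [Fintype F] in
lemma towerTwist_injOn {y : ℕ → K} (hy0 : y 0 = 1) {c c' : ℕ → F} {n : ℕ}
    (h : ∀ j ≤ n, towerTwist c y j = towerTwist c' y j) {j : ℕ} (hj : j ≤ n) : c j = c' j := by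
  induction j using Nat.strong_induction_on with
  | _ j ih =>
    have h1 := h j hj
    simp only [towerTwist] at h1
    rw [sum_range_succ', sum_range_succ'] at h1
    have h2 : ∑ i ∈ range j, c (j - (i + 1)) • y (i + 1) =
        ∑ i ∈ range j, c' (j - (i + 1)) • y (i + 1) :=
      sum_congr rfl fun i hi => by
        rw [mem_range] at hi
        rw [ih (j - (i + 1)) (by omega) (by omega)]
    rw [h2] at h1
    have h3 := add_left_cancel h1
    rw [hy0, Nat.sub_zero, ← Algebra.algebraMap_eq_smul_one, ← Algebra.algebraMap_eq_smul_one] at h3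
    exact (algebraMap F K).injective h3

lemma mk_pow_card_pow {x : K} {y : ℕ → K} (hy0 : y 0 = 1)
    (hy : ∀ j, y (j + 1) ^ Fintype.card F = y (j + 1) - x * y j) (r : ℕ) :
    PowerSeries.mk (fun j => y j ^ Fintype.card F ^ r) = PowerSeries.mk y *
      ∏ i ∈ range r, (1 - PowerSeries.C (x ^ Fintype.card F ^ i) * PowerSeries.X) := by
  have hmul : ∀ (z : ℕ → K) (a : K),
      PowerSeries.mk z * (1 - PowerSeries.C a * PowerSeries.X) =
        PowerSeries.mk fun j => z j - if j = 0 then 0 else a * z (j - 1) := fun z a => by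
    ext j
    rw [mul_sub, mul_one, map_sub, PowerSeries.coeff_mk, PowerSeries.coeff_mk, ← mul_assoc,
      mul_comm (PowerSeries.mk z)]
    rcases j with _ | j
    · simp
    · rw [PowerSeries.coeff_succ_mul_X, PowerSeries.coeff_C_mul]
      simp
  induction r with
  | zero => simp
  | succ r ih =>
    rw [prod_range_succ, ← mul_assoc, ← ih, hmul]
    congr 1
    funext j
    obtain ⟨φ, hφ⟩ := exists_algHom_eq_pow F K r
    rcases j with _ | j
    · simp [hy0]
    · rw [if_neg (by omega), pow_succ', pow_mul, hy, Nat.add_sub_cancel]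
      simp only [← hφ, map_sub, map_mul]

lemma isTwistedFixed_of_prime_power {f p : Polynomial F} (hpm : p.Monic) (hp : Irreducible p)
    {k : ℕ} (hf : f = p ^ k) {x : K} (hx : Polynomial.aeval x p = 0) (d : ℕ) {y : ℕ → K}
    (hy0 : y 0 = 1) (hy : ∀ j, y (j + 1) ^ Fintype.card F = y (j + 1) - x * y j) :
    IsTwistedFixed (Fintype.card F) d (Fintype.card F ^ f.natDegree)
      (OneUnits.ofPoly d f).coeff x y := by
  have hfm : f.Monic := hf ▸ hpm.pow k
  have hdeg : f.natDegree = p.natDegree * k := by rw [hf, hpm.natDegree_pow, mul_comm]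
  refine ⟨⟨hy0, fun j _ => hy j⟩, ?_, fun j hj => ?_⟩
  · exact pow_card_pow_of_aeval_eq_zero hp hx (hdeg ▸ dvd_mul_right _ _)
  · have h := congrArg (PowerSeries.coeff (j + 1)) (mk_pow_card_pow hy0 hy f.natDegree)
    rw [PowerSeries.coeff_mk, ← coe_reverse_prod_X_sub, hdeg,
      prod_X_sub_pow_card_of_dvd hpm hp hx, ← hf, ← hdeg, reverse_map_of_injective,
      PowerSeries.coeff_mul, Nat.sum_antidiagonal_eq_sum_range_succ_mk] at h
    rw [h, towerTwist]
    refine sum_congr rfl fun i _ => ?_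
    rw [OneUnits.coeff_ofPoly hfm (by omega), PowerSeries.coeff_mk, Polynomial.coeff_coe,
      Polynomial.coeff_map, Algebra.smul_def, mul_comm]

/-- The number of points over a class is bounded, with a square root error term. -/
lemma exists_mangoldtCount_le (F : Type*) [Field F] [Fintype F] (d : ℕ) :
    ∃ A : ℕ, ∀ s s' : ℕ, s ≤ s' → A ≤ Fintype.card F ^ s' → ∀ c : OneUnits F d,
      Fintype.card F ^ d * mangoldtCount (s + s') c ≤
        Fintype.card F ^ (s + s') + A * Fintype.card F ^ s' := by
  obtain ⟨A, hA⟩ := exists_card_twistedFixed_le F (K := AlgebraicClosure F) d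
  refine ⟨A, fun s s' hss hAs c => ?_⟩
  set K := AlgebraicClosure F
  set r := s + s' with hr
  set B := (monicPolys F r).filter fun f => OneUnits.ofPoly d f = c ∧ polyVonMangoldt f ≠ 0
  set S : Finset K := B.biUnion fun f => (f.map (algebraMap F K)).roots.toFinset with hS
  have hB : ∀ f ∈ B, f.Monic ∧ f.natDegree = r ∧ OneUnits.ofPoly d f = c ∧
      ∃ p, p.Monic ∧ Irreducible p ∧ ∃ k, 1 ≤ k ∧ f = p ^ k := fun f hf => by
    rw [mem_filter, mem_monicPolys] at hf
    exact ⟨hf.1.1, hf.1.2, hf.2.1, exists_monic_eq_pow hf.1.1 hf.2.2⟩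
  have hroot : ∀ f ∈ B, ∀ x ∈ (f.map (algebraMap F K)).roots.toFinset,
      ∃ p, p.Monic ∧ Irreducible p ∧ (∃ k, f = p ^ k) ∧ Polynomial.aeval x p = 0 := by
    intro f hf x hx
    obtain ⟨-, -, -, p, hpm, hp, k, hk, rfl⟩ := hB f hf
    refine ⟨p, hpm, hp, ⟨k, rfl⟩, ?_⟩
    rw [Multiset.mem_toFinset, Polynomial.mem_roots', Polynomial.IsRoot.def, Polynomial.eval_map,
      ← Polynomial.aeval_def, map_pow] at hx
    exact pow_eq_zero_iff (by omega) |>.1 hx.2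
  have hSB : ∀ x ∈ S, ∃ f ∈ B, x ∈ (f.map (algebraMap F K)).roots.toFinset := fun x hx =>
    mem_biUnion.1 hx
  have hcard : #S = mangoldtCount r c := by
    rw [hS, card_biUnion]
    · rw [mangoldtCount]
      refine Eq.trans ?_ (sum_filter_ne_zero _)
      rw [filter_filter]
      refine sum_congr rfl fun f hf => ?_
      obtain ⟨-, -, -, p, hpm, hp, k, hk, rfl⟩ := hB f hf
      exact card_roots_of_prime_power hp hk
    · intro f hf g hg hfg
      refine disjoint_left.2 fun x hxf hxg => hfg ?_
      obtain ⟨p, hpm, hp, ⟨k, hk⟩, hpx⟩ := hroot f hf x hxf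
      obtain ⟨p', hpm', hp', ⟨k', hk'⟩, hpx'⟩ := hroot g hg x hxg
      have e1 := prod_X_sub_pow_card_of_dvd hpm hp hpx k
      have e2 := prod_X_sub_pow_card_of_dvd hpm' hp' hpx' k'
      rw [mul_comm, ← hpm.natDegree_pow, ← hk, (hB f hf).2.1] at e1
      rw [mul_comm, ← hpm'.natDegree_pow, ← hk', (hB g hg).2.1, e1] at e2
      exact Polynomial.map_injective _ (algebraMap F K).injective e2
  choose y hy hy' using fun x : K => exists_isLangTower (q := Fintype.card F)
    Fintype.one_lt_card d x
  have := hA s s' hss hAs c.coeff (S × OneUnits F d) (fun z => z.1)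
    (fun z => towerTwist z.2.coeff (y z.1)) (by
      rintro ⟨⟨x, hx⟩, v⟩
      obtain ⟨f, hf, hxf⟩ := hSB x hx
      obtain ⟨p, hpm, hp, ⟨k, hk⟩, hpx⟩ := hroot f hf x hxf
      have h := isTwistedFixed_of_prime_power hpm hp hk hpx d
        (towerTwist_zero (hy' x).zero v.coeff_zero)
        (towerTwist_pow_card (hy' x).zero (hy x) v.coeff)
      rwa [(hB f hf).2.1, (hB f hf).2.2.1] at h) (by
      rintro ⟨⟨x, hx⟩, v⟩ ⟨⟨x', hx'⟩, v'⟩ hxx h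
      obtain rfl : x = x' := hxx
      refine Prod.ext rfl (OneUnits.ext_coeff fun j _ hj => ?_)
      refine towerTwist_injOn (n := d) (hy' x).zero (fun i hi => ?_) hj
      rcases i with _ | i
      · rw [towerTwist_zero (hy' x).zero v.coeff_zero, towerTwist_zero (hy' x).zero v'.coeff_zero]
      · exact h i hi)
  rwa [Fintype.card_prod, Fintype.card_coe, hcard, OneUnits.card_eq, mul_comm] at this

end PointCount

section NewtonSums

open Polynomial

lemma summable_norm_mul_pow {u : ℕ → ℂ} {ρ A : ℝ} (hu : ∀ r, ‖u r‖ ≤ A * ρ ^ r) (hρ : 0 ≤ ρ)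
    {z : ℂ} (hz : ‖z‖ * ρ < 1) : Summable fun r => ‖u r * z ^ r‖ := by
  refine Summable.of_nonneg_of_le (fun _ => norm_nonneg _) (fun r => ?_)
    ((summable_geometric_of_lt_one (by positivity) hz).mul_left A)
  rw [norm_mul, norm_pow, mul_pow, mul_comm (‖z‖ ^ r), ← mul_assoc]
  exact mul_le_mul_of_nonneg_right (hu r) (by positivity)

lemma Polynomial.hasSum_coeff_mul_pow (P : ℂ[X]) (z : ℂ) :
    HasSum (fun n => P.coeff n * z ^ n) (P.eval z) := by
  rw [eval_eq_sum_range]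
  refine hasSum_sum_of_ne_finset_zero fun n hn => ?_
  rw [coeff_eq_zero_of_natDegree_lt (by simpa using hn), zero_mul]

lemma Polynomial.eval_mul_tsum {P Q : ℂ[X]} {u : ℕ → ℂ}
    (h : (P : PowerSeries ℂ) * PowerSeries.mk u = Q) {z : ℂ}
    (hu : Summable fun r => ‖u r * z ^ r‖) : P.eval z * ∑' r, u r * z ^ r = Q.eval z := by
  have hP : Summable fun r => ‖P.coeff r * z ^ r‖ := by
    refine summable_of_ne_finset_zero (s := range (P.natDegree + 1)) fun n hn => ?_
    rw [coeff_eq_zero_of_natDegree_lt (by simpa using hn), zero_mul, norm_zero]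
  rw [← (hasSum_coeff_mul_pow P z).tsum_eq, ← (hasSum_coeff_mul_pow Q z).tsum_eq,
    tsum_mul_tsum_eq_tsum_sum_antidiagonal_of_summable_norm hP hu]
  refine tsum_congr fun n => ?_
  rw [← Polynomial.coeff_coe, ← h, PowerSeries.coeff_mul, sum_mul]
  refine sum_congr rfl fun ij hij => ?_
  rw [← HasAntidiagonal.mem_antidiagonal.1 hij, Polynomial.coeff_coe, PowerSeries.coeff_mk, pow_add]
  ring

lemma one_le_norm_mul_of_isRoot {P : ℂ[X]} (hP : P.coeff 0 = 1) {u : ℕ → ℂ}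
    (h : (P : PowerSeries ℂ) * PowerSeries.mk u = (X * derivative P : ℂ[X])) {ρ A : ℝ}
    (hρ : 0 ≤ ρ) (hu : ∀ r, ‖u r‖ ≤ A * ρ ^ r) {z : ℂ} (hz : P.eval z = 0) : 1 ≤ ‖z‖ * ρ := by
  by_contra! hlt
  have hP0 : P ≠ 0 := by rintro rfl; simp at hP
  have hz0 : z ≠ 0 := by
    rintro rfl
    rw [← coeff_zero_eq_eval_zero, hP] at hz
    exact one_ne_zero hz
  obtain ⟨P₁, hP₁, hdvd⟩ := exists_eq_pow_rootMultiplicity_mul_and_not_dvd P hP0 z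
  obtain ⟨e, he⟩ : ∃ e, P.rootMultiplicity z = e + 1 :=
    ⟨P.rootMultiplicity z - 1, by have := (rootMultiplicity_pos hP0).2 hz; omega⟩
  rw [he] at hP₁
  have hder : X * derivative P = (X - C z) ^ e *
      (X * (C (e + 1 : ℂ) * P₁ + (X - C z) * derivative P₁)) := by
    rw [hP₁, derivative_mul, derivative_X_sub_C_pow]
    push_cast
    simp only [map_add, map_one]
    ring
  have hne : (((X - C z) ^ e : ℂ[X]) : PowerSeries ℂ) ≠ 0 := by
    rw [Ne, Polynomial.coe_eq_zero_iff]
    exact pow_ne_zero _ (X_sub_C_ne_zero z)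
  have h' : (((X - C z) * P₁ : ℂ[X]) : PowerSeries ℂ) * PowerSeries.mk u =
      (X * (C (e + 1 : ℂ) * P₁ + (X - C z) * derivative P₁) : ℂ[X]) := by
    refine mul_left_cancel₀ hne ?_
    rw [← mul_assoc, ← Polynomial.coe_mul, ← Polynomial.coe_mul, ← hder, ← h, ← mul_assoc,
      ← pow_succ, ← hP₁]
  have := eval_mul_tsum h' (summable_norm_mul_pow hu hρ hlt)
  simp only [eval_mul, eval_sub, eval_X, eval_C, sub_self, zero_mul, eval_add, add_zero] at this
  have h1 : P₁.eval z ≠ 0 := fun h => hdvd (dvd_iff_isRoot.2 h)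
  have h2 : (e + 1 : ℂ) ≠ 0 := by exact_mod_cast e.succ_ne_zero
  exact mul_ne_zero hz0 (mul_ne_zero h2 h1) this.symm

lemma norm_coeff_le_of_isRoot {P : ℂ[X]} (hP : P.coeff 0 = 1) {d : ℕ} (hd : P.natDegree ≤ d)
    {ρ : ℝ} (hρ : 0 ≤ ρ) (h : ∀ z, P.eval z = 0 → 1 ≤ ‖z‖ * ρ) {j : ℕ} (hj : j ≤ d) :
    ‖P.coeff j‖ ≤ 2 ^ d * ρ ^ j := by
  set R := P.reflect d with hR
  have hcoeff : ∀ i ≤ d, R.coeff (d - i) = P.coeff i := fun i hi => by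
    rw [hR, coeff_reflect, revAt_le (Nat.sub_le _ _), Nat.sub_sub_self hi]
  have hdeg : R.natDegree ≤ d := by
    refine (natDegree_reflect_le ..).trans (max_le le_rfl hd)
  have hlead : R.coeff d = 1 := by rw [← hP, ← hcoeff 0 (Nat.zero_le _), Nat.sub_zero]
  have hmon : R.Monic := monic_of_natDegree_le_of_coeff_eq_one d hdeg hlead
  have hdeg' : R.natDegree = d := hdeg.antisymm (le_natDegree_of_ne_zero (by rw [hlead]; simp))
  have hroots : ∀ w ∈ (R.map (RingHom.id ℂ)).roots, ‖w‖ ≤ ρ := by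
    intro w hw
    rw [Polynomial.map_id, mem_roots hmon.ne_zero, IsRoot.def] at hw
    rcases eq_or_ne w 0 with rfl | hw0
    · simpa using hρ
    have hinv : Invertible w⁻¹ := invertibleOfNonzero (inv_ne_zero hw0)
    have h1 := eval₂_reflect_mul_pow (RingHom.id ℂ) w⁻¹ d P hd
    have hw' : ⅟(w⁻¹) = w := by rw [invOf_eq_inv, inv_inv]
    rw [hw', ← hR, eval₂_id, hw, zero_mul, eval₂_id] at h1
    have h2 := h _ h1.symm
    rwa [norm_inv, inv_mul_eq_div, one_le_div (norm_pos_iff.2 hw0)] at h2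
  have := coeff_le_of_roots_le (d - j) hmon (IsAlgClosed.splits _) hroots
  rw [Polynomial.map_id, hcoeff j hj, hdeg', Nat.sub_sub_self hj, mul_comm] at this
  refine this.trans (mul_le_mul_of_nonneg_right ?_ (by positivity))
  exact_mod_cast Nat.choose_le_two_pow d (d - j)

/-- The coefficients `a` of a polynomial whose logarithmic derivative has coefficients of size
`O(ρ ^ r)` are bounded uniformly. -/
lemma norm_coeff_le_of_newton {a u : ℕ → ℂ} {d : ℕ} (ha0 : a 0 = 1) (had : ∀ r, d ≤ r → a r = 0)
    (h : ∀ r, ∑ ij ∈ antidiagonal r, u ij.1 * a ij.2 = r * a r) {ρ A : ℝ} (hρ : 0 ≤ ρ)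
    (hu : ∀ r, ‖u r‖ ≤ A * ρ ^ r) (j : ℕ) : ‖a j‖ ≤ 2 ^ d * ρ ^ j := by
  rcases le_or_gt d j with hj | hj
  · rw [had j hj, norm_zero]; positivity
  set P : ℂ[X] := ∑ i ∈ range d, C (a i) * X ^ i with hP
  have hcoeff : ∀ i, P.coeff i = a i := fun i => by
    simp only [hP, finsetSum_coeff, coeff_C_mul, coeff_X_pow, mul_ite, mul_one, mul_zero,
      sum_ite_eq, mem_range]
    split_ifs with hi
    · rfl
    · rw [had i (by omega)]
  have hdeg : P.natDegree ≤ d := natDegree_le_iff_coeff_eq_zero.2 fun N hN => by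
    rw [hcoeff, had N (by omega)]
  have hrel : (P : PowerSeries ℂ) * PowerSeries.mk u = (X * derivative P : ℂ[X]) := by
    ext r
    rw [mul_comm, PowerSeries.coeff_mul, Polynomial.coeff_coe]
    simp only [PowerSeries.coeff_mk, Polynomial.coeff_coe, hcoeff]
    rw [h]
    rcases r with _ | r
    · simp
    · rw [coeff_X_mul, coeff_derivative, hcoeff, mul_comm]; push_cast; rfl
  rw [← hcoeff]
  exact norm_coeff_le_of_isRoot (by rw [hcoeff, ha0]) hdeg hρ
    (fun z hz => one_le_norm_mul_of_isRoot (by rw [hcoeff, ha0]) hrel hρ hu hz) hj.le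

lemma exists_norm_newton_le (D : ℝ) (hD : 0 ≤ D) (n : ℕ) :
    ∃ B : ℝ, 0 ≤ B ∧ ∀ (a u : ℕ → ℂ) (ρ : ℝ), 0 ≤ ρ → a 0 = 1 → (∀ j, ‖a j‖ ≤ D * ρ ^ j) →
      (∀ r, ∑ ij ∈ antidiagonal r, u ij.1 * a ij.2 = r * a r) → ∀ i ≤ n, ‖u i‖ ≤ B * ρ ^ i := by
  induction n with
  | zero =>
    refine ⟨0, le_rfl, fun a u ρ _ ha0 _ h i hi => ?_⟩
    obtain rfl : i = 0 := by omega
    have := h 0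
    simp only [Nat.antidiagonal_zero, sum_singleton, ha0, mul_one, Nat.cast_zero] at this
    simp [this]
  | succ n ih =>
    obtain ⟨B, hB, ih⟩ := ih
    refine ⟨B + ((n + 1 : ℕ) * D + (n + 1 : ℕ) * (B * D)), by positivity,
      fun a u ρ hρ ha0 ha h i hi => ?_⟩
    have ih := ih a u ρ hρ ha0 ha h
    rcases Nat.lt_or_eq_of_le hi with hi | rfl
    · refine (ih i (by omega)).trans (mul_le_mul_of_nonneg_right ?_ (by positivity))
      exact le_add_of_nonneg_right (by positivity)
    have h1 := h (n + 1)
    rw [Nat.sum_antidiagonal_eq_sum_range_succ_mk, sum_range_succ, Nat.sub_self, ha0, mul_one] at h1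
    rw [← eq_sub_iff_add_eq'] at h1
    rw [h1]
    refine (norm_sub_le _ _).trans ?_
    have h2 : ‖((n + 1 : ℕ) : ℂ) * a (n + 1)‖ ≤ (n + 1 : ℕ) * D * ρ ^ (n + 1) := by
      rw [norm_mul, Complex.norm_natCast, mul_assoc]
      exact mul_le_mul_of_nonneg_left (ha _) (by positivity)
    have h3 : ‖∑ k ∈ range (n + 1), u k * a (n + 1 - k)‖ ≤
        (n + 1 : ℕ) * (B * D) * ρ ^ (n + 1) := by
      refine (norm_sum_le_of_le _ (f := fun k => u k * a (n + 1 - k))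
        (n := fun _ => B * D * ρ ^ (n + 1)) fun k hk => ?_).trans_eq (by simp [mul_assoc])
      rw [mem_range] at hk
      rw [norm_mul]
      refine (mul_le_mul (ih k (by omega)) (ha _) (norm_nonneg _) (by positivity)).trans_eq ?_
      rw [mul_mul_mul_comm, ← pow_add, Nat.add_sub_cancel' hk.le]
    have : 0 ≤ B * ρ ^ (n + 1) := by positivity
    linarith

end NewtonSums

section CharacterBound

variable {F : Type*} [Field F] [Fintype F]

lemma exists_mangoldtCount_le_add (F : Type*) [Field F] [Fintype F] (d : ℕ) :
    ∃ A : ℝ, 0 ≤ A ∧ ∀ r : ℕ, 1 ≤ r → ∀ c : OneUnits F d,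
      (mangoldtCount r c : ℝ) ≤ (Fintype.card F : ℝ) ^ r / (Fintype.card F : ℝ) ^ d +
        A * √(Fintype.card F) ^ r := by
  obtain ⟨A, hA⟩ := exists_mangoldtCount_le F d
  set q := Fintype.card F with hq
  have hq1 : 1 ≤ q := Fintype.card_pos
  have hqR : (1 : ℝ) ≤ q := by exact_mod_cast hq1
  have hρ : 1 ≤ √(q : ℝ) := Real.one_le_sqrt.2 hqR
  refine ⟨A * √q, by positivity, fun r hr c => ?_⟩
  obtain ⟨s, s', hss, hs, hr'⟩ : ∃ s s', s ≤ s' ∧ 2 * s' ≤ r + 1 ∧ s + s' = r :=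
    ⟨r / 2, r - r / 2, by omega, by omega, by omega⟩
  have hs' : (q : ℝ) ^ s' ≤ √q * √q ^ r := by
    rw [← Real.sq_sqrt (Nat.cast_nonneg q), ← pow_mul, Real.sqrt_sq (Real.sqrt_nonneg _),
      ← pow_succ']
    exact pow_le_pow_right₀ hρ hs
  have hd : (0 : ℝ) < (q : ℝ) ^ d := by positivity
  have key : (mangoldtCount r c : ℝ) ≤ (q : ℝ) ^ r / (q : ℝ) ^ d + A * (q : ℝ) ^ s' := by
    rcases le_or_gt A (q ^ s') with h | h
    · have h1 : (q : ℝ) ^ d * mangoldtCount r c ≤ (q : ℝ) ^ r + A * (q : ℝ) ^ s' := by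
        have := hA s s' hss h c
        rw [hr'] at this
        exact_mod_cast this
      rw [← le_div_iff₀' hd, add_div] at h1
      exact h1.trans (add_le_add_right (div_le_self (by positivity) (one_le_pow₀ hqR)) _)
    · have h1 : mangoldtCount r c ≤ A * q ^ s' := by
        refine (mangoldtCount_le hr c).trans ?_
        rw [← hr', pow_add]
        exact Nat.mul_le_mul_right _ ((pow_le_pow_right₀ hq1 hss).trans h.le)
      have h2 : (mangoldtCount r c : ℝ) ≤ A * (q : ℝ) ^ s' := by exact_mod_cast h1
      exact h2.trans (le_add_of_nonneg_left (by positivity))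
  refine key.trans (add_le_add_right ?_ _)
  rw [mul_assoc]
  exact mul_le_mul_of_nonneg_left hs' (Nat.cast_nonneg _)

lemma sum_abs_le_of_sum_eq_zero {ι : Type*} (s : Finset ι) {g : ι → ℝ} {E : ℝ} (hE : 0 ≤ E)
    (h0 : ∑ i ∈ s, g i = 0) (h : ∀ i ∈ s, g i ≤ E) : ∑ i ∈ s, |g i| ≤ 2 * (#s * E) := by
  have h1 : ∀ i, |g i| = 2 * max (g i) 0 - g i := fun i => by
    rcases le_total (g i) 0 with hi | hi
    · rw [abs_of_nonpos hi, max_eq_right hi]; ring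
    · rw [abs_of_nonneg hi, max_eq_left hi]; ring
  simp only [h1, sum_sub_distrib, h0, sub_zero, ← mul_sum]
  refine mul_le_mul_of_nonneg_left ?_ zero_le_two
  rw [← nsmul_eq_mul]
  exact sum_le_card_nsmul _ _ _ fun i hi => max_le (h i hi) hE

lemma sum_mangoldtCount_sub {r d : ℕ} (hr : 1 ≤ r) :
    ∑ v : OneUnits F d, ((mangoldtCount r v : ℝ) -
      (Fintype.card F : ℝ) ^ r / (Fintype.card F : ℝ) ^ d) = 0 := by
  have h := sum_mangoldtCount (F := F) (d := d) hr
  have hq : (Fintype.card F : ℝ) ≠ 0 := by exact_mod_cast Fintype.card_ne_zero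
  rw [sum_sub_distrib, ← Nat.cast_sum, h, sum_const, card_univ, OneUnits.card_eq, nsmul_eq_mul]
  push_cast
  field_simp
  ring

lemma sum_mangoldtCount_sub_mul {d : ℕ} {χ : AddChar (OneUnits F d) ℂ} (hχ : χ ≠ 0) (r : ℕ)
    (M : ℝ) :
    ∑ v, (((mangoldtCount r v : ℝ) - M : ℝ) : ℂ) * χ v = mangoldtSum χ r := by
  simp only [Complex.ofReal_sub, sub_mul, sum_sub_distrib, ← mul_sum, AddChar.sum_eq_ite,
    if_neg hχ, mul_zero, sub_zero]
  simp [mangoldtSum]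

lemma exists_norm_mangoldtSum_le (F : Type*) [Field F] [Fintype F] (d : ℕ) :
    ∃ A : ℝ, ∀ (χ : AddChar (OneUnits F d) ℂ), χ ≠ 0 → ∀ r : ℕ,
      ‖mangoldtSum χ r‖ ≤ A * √(Fintype.card F) ^ r := by
  obtain ⟨A, hA0, hA⟩ := exists_mangoldtCount_le_add F d
  refine ⟨2 * (Fintype.card F ^ d * A), fun χ hχ r => ?_⟩
  rcases Nat.eq_zero_or_pos r with rfl | hr
  · rw [mangoldtSum_zero, norm_zero]; positivity
  rw [← sum_mangoldtCount_sub_mul hχ r ((Fintype.card F : ℝ) ^ r / (Fintype.card F : ℝ) ^ d)]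
  refine (norm_sum_le _ _).trans ?_
  simp only [norm_mul, AddChar.norm_apply, mul_one, Complex.norm_real, Real.norm_eq_abs]
  refine (sum_abs_le_of_sum_eq_zero univ (E := A * √(Fintype.card F) ^ r) (by positivity)
    (sum_mangoldtCount_sub hr) fun v _ => ?_).trans_eq ?_
  · rw [sub_le_iff_le_add']
    exact hA r hr v
  · rw [card_univ, OneUnits.card_eq]; push_cast; ring

/-- The square root bound for nontrivial character sums, uniformly in the finite field. -/
lemma exists_forall_norm_mangoldtSum_le (d n : ℕ) :
    ∃ B : ℝ, 0 ≤ B ∧ ∀ (F : Type*) [Field F] [Fintype F] (χ : AddChar (OneUnits F d) ℂ), χ ≠ 0 →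
      ‖mangoldtSum χ n‖ ≤ B * √(Fintype.card F) ^ n := by
  obtain ⟨B, hB, h⟩ := exists_norm_newton_le (2 ^ d) (by positivity) n
  refine ⟨B, hB, fun F _ _ χ hχ => ?_⟩
  obtain ⟨A, hA⟩ := exists_norm_mangoldtSum_le F d
  have hnew := sum_antidiagonal_mangoldtSum_mul_charSum χ
  exact h (charSum χ) (mangoldtSum χ) _ (Real.sqrt_nonneg _) (charSum_zero χ)
    (norm_coeff_le_of_newton (charSum_zero χ) (fun r hr => charSum_eq_zero hχ hr) hnew
      (Real.sqrt_nonneg _) (hA χ hχ)) hnew n le_rfl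

lemma sum_norm_sq_sum_mul_addChar {G : Type*} [AddCommGroup G] [Fintype G] (g : G → ℝ) :
    ∑ χ : AddChar G ℂ, ‖∑ v, (g v : ℂ) * χ v‖ ^ 2 = Fintype.card G * ∑ v, g v ^ 2 := by
  have h : ∀ χ : AddChar G ℂ, ((‖∑ v, (g v : ℂ) * χ v‖ ^ 2 : ℝ) : ℂ) =
      ∑ v, ∑ w, (g v : ℂ) * g w * χ (v - w) := fun χ => by
    rw [Complex.ofReal_pow, ← Complex.mul_conj', map_sum, sum_mul_sum]
    refine sum_congr rfl fun v _ => sum_congr rfl fun w _ => ?_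
    rw [map_mul, Complex.conj_ofReal, sub_eq_add_neg, AddChar.map_add_eq_mul,
      AddChar.map_neg_eq_conj]
    ring
  rw [← Complex.ofReal_inj, Complex.ofReal_sum, sum_congr rfl fun χ _ => h χ, sum_comm]
  push_cast
  rw [mul_sum]
  refine sum_congr rfl fun v _ => ?_
  rw [sum_comm]
  simp only [← mul_sum, AddChar.sum_apply_eq_ite, sub_eq_zero, mul_ite, mul_zero, sum_ite_eq,
    mem_univ, if_true]
  ring

/-- The variance of the von Mangoldt function in short intervals, uniformly in the finite field. -/
lemma exists_sum_sq_mangoldtCount_sub_le (k d : ℕ) (hk : 1 ≤ k) :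
    ∃ B : ℝ, 0 ≤ B ∧ ∀ (F : Type*) [Field F] [Fintype F],
      ∑ v : OneUnits F d, ((mangoldtCount (k + d) v : ℝ) - (Fintype.card F : ℝ) ^ k) ^ 2 ≤
        B * (Fintype.card F : ℝ) ^ (k + d) := by
  obtain ⟨B, hB, h⟩ := exists_forall_norm_mangoldtSum_le d (k + d)
  refine ⟨B ^ 2, by positivity, fun F _ _ => ?_⟩
  set q := Fintype.card F with hq
  have hq0 : (0 : ℝ) < q := by exact_mod_cast Fintype.card_pos
  have hdiv : (q : ℝ) ^ (k + d) / (q : ℝ) ^ d = (q : ℝ) ^ k := by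
    rw [pow_add, mul_div_cancel_right₀ _ (by positivity)]
  have h1 := sum_norm_sq_sum_mul_addChar fun v : OneUnits F d =>
    (mangoldtCount (k + d) v : ℝ) - (q : ℝ) ^ k
  have h2 : ∀ χ : AddChar (OneUnits F d) ℂ,
      ‖∑ v, (((mangoldtCount (k + d) v : ℝ) - (q : ℝ) ^ k : ℝ) : ℂ) * χ v‖ ^ 2 ≤
        B ^ 2 * (q : ℝ) ^ (k + d) := fun χ => by
    rcases eq_or_ne χ 0 with rfl | hχ
    · have h3 := sum_mangoldtCount_sub (F := F) (d := d) (show 1 ≤ k + d by omega)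
      rw [← hq, hdiv] at h3
      simp only [AddChar.zero_apply, mul_one, ← Complex.ofReal_sum, h3]
      simp only [Complex.ofReal_zero, norm_zero, zero_pow two_ne_zero]
      positivity
    · rw [sum_mangoldtCount_sub_mul hχ]
      refine (pow_le_pow_left₀ (norm_nonneg _) (h F χ hχ) 2).trans_eq ?_
      rw [mul_pow, ← pow_mul, mul_comm (k + d), pow_mul, Real.sq_sqrt (Nat.cast_nonneg _)]
  have h3 := sum_le_card_nsmul univ _ _ fun χ _ => h2 χ
  rw [h1, card_univ, AddChar.card_eq, nsmul_eq_mul] at h3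
  exact le_of_mul_le_mul_left h3 (by exact_mod_cast Fintype.card_pos)

end CharacterBound

section Moments

lemma exists_abs_pow_sub_le (A : ℝ) (hA : 0 ≤ A) (j : ℕ) :
    ∃ B : ℝ, 0 ≤ B ∧ ∀ x H : ℝ, 0 ≤ x → 0 ≤ H → x ≤ A * H →
      |x ^ (j + 2) - H ^ (j + 2) - (j + 2) * H ^ (j + 1) * (x - H)| ≤ B * H ^ j * (x - H) ^ 2 := by
  induction j with
  | zero =>
    refine ⟨1, zero_le_one, fun x H _ _ _ => ?_⟩
    have : x ^ (0 + 2) - H ^ (0 + 2) - ((0 : ℕ) + 2) * H ^ (0 + 1) * (x - H) = (x - H) ^ 2 := by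
      push_cast; ring
    rw [this, abs_of_nonneg (sq_nonneg _), pow_zero, one_mul, one_mul]
  | succ j ih =>
    obtain ⟨B, hB, ih⟩ := ih
    refine ⟨A * B + (j + 2), by positivity, fun x H hx hH hxH => ?_⟩
    have : x ^ (j + 1 + 2) - H ^ (j + 1 + 2) - ((j + 1 : ℕ) + 2) * H ^ (j + 1 + 1) * (x - H) =
        x * (x ^ (j + 2) - H ^ (j + 2) - (j + 2) * H ^ (j + 1) * (x - H)) +
          (j + 2) * H ^ (j + 1) * (x - H) ^ 2 := by
      push_cast; ring
    rw [this]
    refine (abs_add_le _ _).trans ?_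
    rw [abs_mul, abs_of_nonneg hx,
      abs_of_nonneg (by positivity : 0 ≤ (j + 2) * H ^ (j + 1) * (x - H) ^ 2)]
    have h1 := mul_le_mul hxH (ih x H hx hH hxH) (abs_nonneg _) (by positivity)
    refine (add_le_add_left h1 _).trans_eq ?_
    ring

lemma polyVonMangoldt_le_natDegree {F : Type*} [Field F] (f : Polynomial F) :
    polyVonMangoldt f ≤ f.natDegree := by
  rw [polyVonMangoldt]
  split_ifs with h
  · obtain ⟨-, k, hk, hf⟩ := h.choose_spec
    calc _ ≤ k * h.choose.natDegree := Nat.le_mul_of_pos_left _ hk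
      _ = f.natDegree := by rw [← Polynomial.natDegree_pow, ← hf]
  · exact Nat.zero_le _

lemma monicOfCoeffs_append_add {F : Type*} [Field F] {k d : ℕ} (a a' : Fin k → F)
    (b : Fin d → F) :
    monicOfCoeffs (k + d) (Fin.append a b) +
      ∑ j : Fin k, Polynomial.C (a' j) * Polynomial.X ^ (j : ℕ) =
      monicOfCoeffs (k + d) (Fin.append (a + a') b) := by
  simp only [monicOfCoeffs, Fin.sum_univ_add, Fin.append_left, Fin.append_right, Fin.val_castAdd,
    Pi.add_apply, map_add, add_mul, sum_add_distrib]
  ring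

lemma sum_polyVonMangoldt_add {F : Type*} [Field F] [Fintype F] {k d : ℕ} (c : Fin (k + d) → F) :
    ∑ a : Fin k → F, polyVonMangoldt (monicOfCoeffs (k + d) c +
      ∑ j : Fin k, Polynomial.C (a j) * Polynomial.X ^ (j : ℕ)) =
      mangoldtCount (k + d) (OneUnits.ofPoly d (monicOfCoeffs (k + d) c)) := by
  obtain ⟨⟨a, b⟩, rfl⟩ := (Fin.appendEquiv k d).surjective c
  simp only [Fin.appendEquiv, Equiv.coe_fn_mk]
  simp only [monicOfCoeffs_append_add, mangoldtCount_ofPoly]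
  exact Equiv.sum_comp (Equiv.addLeft a) fun a' =>
    polyVonMangoldt (monicOfCoeffs (k + d) (Fin.append a' b))

lemma mangoldtCount_ofPoly_le {F : Type*} [Field F] [Fintype F] {k d : ℕ} (c : Fin (k + d) → F) :
    mangoldtCount (k + d) (OneUnits.ofPoly d (monicOfCoeffs (k + d) c)) ≤
      (k + d) * Fintype.card F ^ k := by
  obtain ⟨⟨a, b⟩, rfl⟩ := (Fin.appendEquiv k d).surjective c
  simp only [Fin.appendEquiv, Equiv.coe_fn_mk]
  rw [mangoldtCount_ofPoly]
  refine (sum_le_card_nsmul _ _ (k + d) fun a' _ => ?_).trans_eq (by simp [mul_comm])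
  exact (polyVonMangoldt_le_natDegree _).trans_eq (natDegree_monicOfCoeffs _ _)

lemma exists_abs_sum_pow_sub_le (j k d : ℕ) (hk : 1 ≤ k) :
    ∃ B : ℝ, 0 ≤ B ∧ ∀ (F : Type*) [Field F] [Fintype F],
      |(1 / (Fintype.card F : ℝ) ^ (k + d)) * (∑ c : Fin (k + d) → F,
          (mangoldtCount (k + d) (OneUnits.ofPoly d (monicOfCoeffs (k + d) c)) : ℝ) ^ (j + 2)) -
        (Fintype.card F : ℝ) ^ (k * (j + 2))| ≤ B * (Fintype.card F : ℝ) ^ (k * (j + 1)) := by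
  obtain ⟨B, hB, hvar⟩ := exists_sum_sq_mangoldtCount_sub_le k d hk
  obtain ⟨A, hA, hpow⟩ := exists_abs_pow_sub_le ((k + d : ℕ) : ℝ) (Nat.cast_nonneg _) j
  refine ⟨A * B, by positivity, fun F _ _ => ?_⟩
  have hvar := hvar F
  set q := Fintype.card F with hq
  have hq0 : (0 : ℝ) < q := by exact_mod_cast Fintype.card_pos
  set H : ℝ := (q : ℝ) ^ k with hH
  have hH0 : 0 < H := by positivity
  set ν : OneUnits F d → ℝ := fun v => mangoldtCount (k + d) v with hν
  set x : (Fin (k + d) → F) → ℝ := fun c => ν (OneUnits.ofPoly d (monicOfCoeffs (k + d) c)) with hx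
  have hzero : ∑ c, (x c - H) = 0 := by
    have h3 := sum_mangoldtCount_sub (F := F) (d := d) (show 1 ≤ k + d by omega)
    rw [← hq, pow_add, mul_div_cancel_right₀ _ (by positivity)] at h3
    rw [sum_ofPoly (fun v => ν v - H), h3, mul_zero]
  have hsq : ∑ c, (x c - H) ^ 2 ≤ H * (B * (q : ℝ) ^ (k + d)) := by
    rw [sum_ofPoly (fun v => (ν v - H) ^ 2)]
    exact mul_le_mul_of_nonneg_left hvar hH0.le
  have hcard : (Fintype.card (Fin (k + d) → F) : ℝ) = (q : ℝ) ^ (k + d) := by simp [hq]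
  have hmain : |∑ c, (x c ^ (j + 2) - H ^ (j + 2))| ≤
      A * B * H ^ (j + 1) * (q : ℝ) ^ (k + d) := by
    have h1 : ∑ c, (x c ^ (j + 2) - H ^ (j + 2)) =
        ∑ c, (x c ^ (j + 2) - H ^ (j + 2) - (j + 2) * H ^ (j + 1) * (x c - H)) := by
      rw [sum_sub_distrib _ (fun c => (j + 2) * H ^ (j + 1) * (x c - H)), ← mul_sum, hzero,
        mul_zero, sub_zero]
    rw [h1]
    refine (abs_sum_le_sum_abs _ _).trans ((sum_le_sum fun c _ => hpow (x c) H
      (Nat.cast_nonneg _) hH0.le ?_).trans ?_)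
    · have := mangoldtCount_ofPoly_le c
      simp only [hx, hν, hH]
      exact_mod_cast this
    · rw [← mul_sum]
      refine (mul_le_mul_of_nonneg_left hsq (by positivity)).trans_eq ?_
      ring
  have hfin : (1 / (q : ℝ) ^ (k + d)) * (∑ c, x c ^ (j + 2)) - (q : ℝ) ^ (k * (j + 2)) =
      (∑ c, (x c ^ (j + 2) - H ^ (j + 2))) / (q : ℝ) ^ (k + d) := by
    rw [sum_sub_distrib, sum_const, card_univ, nsmul_eq_mul, hcard, hH, ← pow_mul]
    field_simp
  rw [hfin, abs_div, abs_of_pos (by positivity : 0 < (q : ℝ) ^ (k + d)),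
    div_le_iff₀ (by positivity), pow_mul]
  exact hmain

end Moments

end AuxiliaryResults

/-- Fix `m ≥ 2`, `n ≥ 4`, `1 ≤ h ≤ n - 3`. There is a `C > 0` such that
for every finite field `F` with `q` elements (of characteristic `> n` when `m > 2`),
`|q⁻ⁿ ∑_{f ∈ M_n(F)} (∑_{deg g ≤ h} Λ(f + g))^m - q^{(h+1)m}| ≤ C q^{(h+1)(m-1)}`. -/
theorem moments_polyVonMangoldt (m n h : ℕ) (hm : 2 ≤ m) (hn : 4 ≤ n) (hh1 : 1 ≤ h)
    (hh2 : h ≤ n - 3) :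
    ∃ C : ℝ, 0 < C ∧ ∀ (F : Type) [Field F] [Fintype F], (2 < m → n < ringChar F) →
      |(1 / (Fintype.card F : ℝ) ^ n) *
          (∑ co : Fin n → F, (∑ a : Fin (h + 1) → F,
            (polyVonMangoldt (monicOfCoeffs n co +
              ∑ j : Fin (h + 1), Polynomial.C (a j) * Polynomial.X ^ (j : ℕ)) : ℝ)) ^ m) -
        (Fintype.card F : ℝ) ^ ((h + 1) * m)| ≤
      C * (Fintype.card F : ℝ) ^ ((h + 1) * (m - 1)) := by
  obtain ⟨d, rfl⟩ : ∃ d, n = h + 1 + d := ⟨n - (h + 1), by omega⟩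
  obtain ⟨j, rfl⟩ : ∃ j, m = j + 2 := ⟨m - 2, by omega⟩
  obtain ⟨B, hB, hmom⟩ := exists_abs_sum_pow_sub_le j (h + 1) d (by omega)
  refine ⟨B + 1, by positivity, fun F _ _ _ => ?_⟩
  simp only [← Nat.cast_sum, sum_polyVonMangoldt_add]
  refine (hmom F).trans (mul_le_mul_of_nonneg_right (by linarith) (by positivity))
end

section
/- Let F be a finite field with q elements, let K be an algebraic closure of F, let n ≥ 1, let σ be a permutation of {1, …, n}, and let f be a squarefree monic polynomial of degree n in F[x]. Let N be the number of tuples (z_1, …, z_n) ∈ K^n such that f = ∏_{j=1}^n (x − z_j) (as polynomials over K) and z_j^q = z_{σ(j)} for all j. If the multiset of degrees of the monic irreducible factors of f equals the multiset of cycle lengths of σ (where fixed points of σ count as cycles of length 1), then N = n! divided by the cardinality of the conjugacy class of σ in the symmetric group S_n; otherwise N = 0. -/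
open scoped Classical

open Equiv.Perm in
/-- On a cycle of length at least two, the minimal period is the length of the cycle. -/
theorem Equiv.Perm.minimalPeriod_eq_card_support {α : Type*} [Fintype α] [DecidableEq α]
    {π c : Equiv.Perm α} (hc : c ∈ π.cycleFactorsFinset) {x : α} (hx : x ∈ c.support) :
    Function.minimalPeriod π x = c.support.card := by
  refine Nat.dvd_right_iff_eq.mp fun m => ?_
  rw [← Function.isPeriodicPt_iff_minimalPeriod_dvd,
    ← (isCycleOn_support_of_mem_cycleFactorsFinset hc).pow_apply_eq hx,
    Function.IsPeriodicPt, Function.IsFixedPt, Equiv.Perm.iterate_eq_pow]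

open Equiv.Perm in
/-- The number of points of minimal period `d` is `d` times the number of cycles of length `d`. -/
theorem Equiv.Perm.card_filter_minimalPeriod_eq {α : Type*} [Fintype α] [DecidableEq α]
    (π : Equiv.Perm α) (d : ℕ) :
    (Finset.univ.filter fun x => Function.minimalPeriod π x = d).card =
      π.partition.parts.count d * d := by
  rw [parts_partition, Multiset.count_add, Multiset.count_replicate]
  by_cases hd : d = 1
  · subst hd
    have h1 : Multiset.count 1 π.cycleType = 0 := Multiset.count_eq_zero.mpr fun h =>
      absurd (one_lt_of_mem_cycleType h) (lt_irrefl 1)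
    rw [h1, if_pos rfl, zero_add, mul_one, ← Finset.card_compl]
    congr 1
    ext x
    simp [Function.minimalPeriod_eq_one_iff_isFixedPt, Function.IsFixedPt]
  · rw [if_neg (Ne.symm hd), add_zero, cycleType_def, Multiset.count_map, ← Finset.filter_val,
      Finset.card_val]
    have hsupp : ∀ x ∈ Finset.univ.filter fun x => Function.minimalPeriod π x = d,
        x ∈ π.support := fun x hx => mem_support.mpr fun h => hd <| by
      rw [← (Finset.mem_filter.mp hx).2]
      exact Function.minimalPeriod_eq_one_iff_isFixedPt.mpr h
    have hmaps : ∀ x ∈ Finset.univ.filter fun x => Function.minimalPeriod π x = d,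
        π.cycleOf x ∈ π.cycleFactorsFinset.filter fun c => d = c.support.card := fun x hx => by
      have hc := cycleOf_mem_cycleFactorsFinset_iff.mpr (hsupp x hx)
      refine Finset.mem_filter.mpr ⟨hc, ?_⟩
      rw [← (Finset.mem_filter.mp hx).2]
      exact minimalPeriod_eq_card_support hc
        ((eq_cycleOf_of_mem_cycleFactorsFinset_iff π _ hc x).mp rfl)
    rw [Finset.card_eq_sum_card_fiberwise hmaps, Finset.sum_const_nat (m := d) ?_]
    · rfl
    intro c hc
    obtain ⟨hc, hcd⟩ := Finset.mem_filter.mp hc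
    rw [hcd]
    congr 1
    ext x
    simp only [Finset.mem_filter, Finset.mem_univ, true_and]
    rw [eq_comm (b := c), eq_cycleOf_of_mem_cycleFactorsFinset_iff π c hc x]
    exact ⟨fun h => h.2, fun h => ⟨minimalPeriod_eq_card_support hc h, h⟩⟩

open Polynomial UniqueFactorizationMonoid

/-- An integral element of a field extension of `F` is fixed by the `m`-th iterate of the `q`-power
Frobenius iff the degree of its minimal polynomial divides `m`. -/
theorem FiniteField.pow_card_pow_eq_self_iff {F K : Type*} [Field F] [Fintype F] [Field K]
    [Algebra F K] {x : K} (hx : IsIntegral F x) (m : ℕ) :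
    x ^ Fintype.card F ^ m = x ↔ (minpoly F x).natDegree ∣ m := by
  rw [(minpoly.irreducible hx).natDegree_dvd_iff_dvd_X_pow_card_pow_sub_X,
    minpoly.dvd_iff, Nat.card_eq_fintype_card]
  simp [sub_eq_zero]

/-- The number of roots whose minimal polynomial has degree `d` is `d` times the number of
irreducible factors of degree `d`. -/
theorem Polynomial.Separable.card_filter_natDegree_minpoly {F K : Type*} [Field F] [Field K]
    [Algebra F K] [IsAlgClosed K] {f : F[X]} (hsep : f.Separable) (d : ℕ) :
    (((f.aroots K).toFinset).filter fun x => (minpoly F x).natDegree = d).card =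
      ((normalizedFactors f).map natDegree).count d * d := by
  have hf := hsep.ne_zero
  have hnodup : (normalizedFactors f).Nodup :=
    (squarefree_iff_nodup_normalizedFactors hf).mp hsep.squarefree
  have hroot : ∀ {x : K}, x ∈ (f.aroots K).toFinset ↔ aeval x f = 0 := fun {x} => by
    rw [Multiset.mem_toFinset, mem_aroots]
    simp [hf]
  have hint : ∀ {x : K}, aeval x f = 0 → IsIntegral F x := fun {x} hx =>
    isAlgebraic_iff_isIntegral.mp ⟨f, hf, hx⟩
  have hmin : ∀ {g : F[X]} {x : K}, g ∈ normalizedFactors f → aeval x g = 0 →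
      minpoly F x = g := fun {g x} hg hx =>
    (minpoly.eq_of_irreducible_of_monic (irreducible_of_normalized_factor g hg) hx
      ((Polynomial.mem_normalizedFactors_iff hf).mp hg).2.1).symm
  rw [Multiset.count_map,
    ← Multiset.toFinset_card_of_nodup (hnodup.filter _)]
  have hmaps : ∀ x ∈ (f.aroots K).toFinset.filter fun x => (minpoly F x).natDegree = d,
      minpoly F x ∈ ((normalizedFactors f).filter fun g => d = g.natDegree).toFinset := by
    intro x hx
    obtain ⟨hx, hd⟩ := Finset.mem_filter.mp hx
    rw [hroot] at hx
    rw [Multiset.mem_toFinset, Multiset.mem_filter]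
    refine ⟨?_, hd.symm⟩
    exact (Polynomial.mem_normalizedFactors_iff hf).mpr
      ⟨minpoly.irreducible (hint hx), minpoly.monic (hint hx), minpoly.dvd F x hx⟩
  rw [Finset.card_eq_sum_card_fiberwise hmaps, Finset.sum_const_nat (m := d) ?_]
  intro g hg
  rw [Multiset.mem_toFinset, Multiset.mem_filter] at hg
  obtain ⟨hg, rfl⟩ := hg
  have hgf := dvd_of_mem_normalizedFactors hg
  have hgsep : g.Separable := hsep.of_dvd hgf
  have hcard : (g.aroots K).toFinset.card = g.natDegree := by
    rw [← card_rootSet_eq_natDegree (K := K) hgsep (IsAlgClosed.splits _)]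
    simp_rw [rootSet_def, Finset.coe_sort_coe, Fintype.card_coe]
  refine Eq.trans ?_ hcard
  congr 1
  ext x
  rw [Finset.mem_filter, Finset.mem_filter, hroot, Multiset.mem_toFinset, mem_aroots]
  constructor
  · rintro ⟨⟨hx, -⟩, rfl⟩
    exact ⟨hgsep.ne_zero, minpoly.aeval F x⟩
  · rintro ⟨-, hx⟩
    have h := hmin hg hx
    exact ⟨⟨aeval_eq_zero_of_dvd_aeval_eq_zero hgf hx, congrArg natDegree h⟩, h⟩

theorem Polynomial.roots_fintype_prod_X_sub_C {ι R : Type*} [Fintype ι] [CommRing R] [IsDomain R]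
    (z : ι → R) : (∏ j, (X - C (z j))).roots = Finset.univ.val.map z := by
  rw [← roots_multiset_prod_X_sub_C (Finset.univ.val.map z), Multiset.map_map]
  rfl

/-- If Frobenius permutes the distinct roots `z j` of `f` through `π`, then the degrees of the
irreducible factors of `f` are the cycle lengths of `π`. -/
theorem FiniteField.map_natDegree_normalizedFactors_eq {F K : Type*} [Field F] [Fintype F]
    [Field K] [Algebra F K] [IsAlgClosed K] {n : ℕ} {f : F[X]} (hsep : f.Separable)
    {z : Fin n → K} (hz : f.map (algebraMap F K) = ∏ j, (X - C (z j)))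
    (hinj : Function.Injective z) {π : Equiv.Perm (Fin n)}
    (hπ : ∀ j, z j ^ Fintype.card F = z (π j)) :
    (normalizedFactors f).map natDegree = π.partition.parts := by
  have hroots : f.aroots K = Finset.univ.val.map z := by
    rw [aroots_def, hz, roots_fintype_prod_X_sub_C]
  have hint : ∀ j, IsIntegral F (z j) := fun j => isAlgebraic_iff_isIntegral.mp
    ⟨f, hsep.ne_zero, by
      have : z j ∈ f.aroots K := by simp [hroots]
      exact (mem_aroots.mp this).2⟩
  have hiter : ∀ m j, z j ^ Fintype.card F ^ m = z ((π ^[m]) j) := by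
    intro m
    induction m with
    | zero => simp
    | succ m ih =>
      intro j
      rw [pow_succ, pow_mul, ih, hπ, Function.iterate_succ_apply']
  have hper : ∀ j, Function.minimalPeriod π j = (minpoly F (z j)).natDegree := fun j => by
    refine Nat.dvd_right_iff_eq.mp fun m => ?_
    rw [← Function.isPeriodicPt_iff_minimalPeriod_dvd,
      ← FiniteField.pow_card_pow_eq_self_iff (hint j), hiter, hinj.eq_iff]
    rfl
  have hpos : ∀ m ∈ (normalizedFactors f).map natDegree, 0 < m := fun m hm => by
    obtain ⟨g, hg, rfl⟩ := Multiset.mem_map.mp hm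
    exact (irreducible_of_normalized_factor g hg).natDegree_pos
  ext d
  rcases Nat.eq_zero_or_pos d with rfl | hd
  · rw [Multiset.count_eq_zero.mpr fun h => (hpos 0 h).ne rfl,
      Multiset.count_eq_zero.mpr fun h => (π.partition.parts_pos h).ne rfl]
  refine Nat.eq_of_mul_eq_mul_right hd ?_
  rw [← hsep.card_filter_natDegree_minpoly (K := K), ← π.card_filter_minimalPeriod_eq]
  symm
  refine Finset.card_bij (fun j _ => z j) ?_ (fun _ _ _ _ h => hinj h) ?_
  · intro j hj
    simpa [hroots, hper] using hj
  · intro x hx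
    rw [Finset.mem_filter, Multiset.mem_toFinset, hroots] at hx
    obtain ⟨⟨j, -, rfl⟩, hj⟩ := And.imp_left Multiset.mem_map.mp hx
    exact ⟨j, by simpa [hper] using hj, rfl⟩

/-- The number of `τ` conjugating `σ` to `π` is the order of the centralizer of `σ`, or zero. -/
theorem Equiv.Perm.ncard_setOf_semiconjBy {n : ℕ} (σ π : Equiv.Perm (Fin n)) :
    Set.ncard {τ : Equiv.Perm (Fin n) | SemiconjBy τ σ π} =
      if IsConj σ π then n.factorial / Set.ncard {τ : Equiv.Perm (Fin n) | IsConj σ τ} else 0 := by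
  split_ifs with h
  · obtain ⟨c, hc⟩ := isConj_iff.mp h
    have hc' : SemiconjBy c σ π := by rw [← hc]; simp [SemiconjBy]
    have himage : {τ : Equiv.Perm (Fin n) | SemiconjBy τ σ π} =
        (fun τ => c * τ) '' (Subgroup.centralizer {σ} : Set (Equiv.Perm (Fin n))) := by
      ext τ
      simp only [Set.image_mul_left, Set.mem_preimage, SetLike.mem_coe,
        Subgroup.mem_centralizer_singleton_iff, Set.mem_ofPred_eq, SemiconjBy]
      rw [mul_assoc, ← mul_assoc σ, ← hc]
      constructor
      · intro h
        rw [h]; group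
      · intro h
        have := congrArg (c * ·) h
        simpa [mul_assoc] using this
    rw [himage, Set.ncard_image_of_injective _ (mul_right_injective c), ← Nat.card_coe_set_eq,
      ← Nat.card_coe_set_eq]
    have hmul := card_isConj_mul_eq σ
    rw [← nat_card_centralizer, Fintype.card_fin] at hmul
    have hpos : 0 < Nat.card {τ : Equiv.Perm (Fin n) | IsConj σ τ} :=
      Nat.pos_of_ne_zero fun h0 => n.factorial_ne_zero (by rw [← hmul, h0, zero_mul])
    exact Nat.eq_div_of_mul_eq_right hpos.ne' hmul
  · rw [Set.ncard_eq_zero]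
    ext τ
    simp only [Set.mem_ofPred_eq, Set.mem_empty_iff_false, iff_false]
    exact fun hτ => h (isConj_iff.mpr ⟨τ, by rw [hτ.eq]; simp⟩)

/-- Let `F` be a finite field with `q` elements, `K` an algebraic closure
of `F`, `σ` a permutation of `{1, …, n}`, and `f` a squarefree monic polynomial of degree
`n ≥ 1` over `F`. The number of tuples `z ∈ K^n` with `f = ∏ (X - C (z j))` over `K` and
`z j ^ q = z (σ j)` for all `j` equals `n!` divided by the cardinality of the conjugacy class
of `σ` if the multiset of degrees of the monic irreducible factors of `f` equals the multiset
of cycle lengths of `σ` (fixed points counting as cycles of length `1`), and `0` otherwise. -/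
theorem ncard_root_orderings_of_squarefree (F : Type*) [Field F] [Fintype F] (K : Type*)
    [Field K] [Algebra F K] [IsAlgClosure F K] (n : ℕ) (hn : 1 ≤ n) (σ : Equiv.Perm (Fin n))
    (f : Polynomial F) (hf : f.Monic) (hdeg : f.natDegree = n) (hsq : Squarefree f) :
    Set.ncard {z : Fin n → K |
        Polynomial.map (algebraMap F K) f =
          ∏ j : Fin n, (Polynomial.X - Polynomial.C (z j)) ∧
        ∀ j, z j ^ Fintype.card F = z (σ j)} =
      if (UniqueFactorizationMonoid.normalizedFactors f).map Polynomial.natDegree =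
          σ.cycleType + Multiset.replicate (n - σ.support.card) 1
        then n.factorial / Set.ncard {τ : Equiv.Perm (Fin n) | IsConj σ τ}
        else 0 := by
  have : IsAlgClosed K := IsAlgClosure.isAlgClosed F
  have hsep : f.Separable := PerfectField.separable_iff_squarefree.mpr hsq
  have hsplit : (f.map (algebraMap F K)).Splits := IsAlgClosed.splits _
  have hcard : Fintype.card (Fin n) = Fintype.card (f.rootSet K) := by
    rw [card_rootSet_eq_natDegree hsep hsplit, hdeg, Fintype.card_fin]
  let e : Fin n ≃ f.rootSet K := Fintype.equivOfCardEq hcard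
  let z : Fin n → K := fun j => e j
  have hinj : Function.Injective z := Subtype.val_injective.comp e.injective
  have hrange : ∀ x, aeval x f = 0 → ∃ j, z j = x := fun x hx =>
    ⟨e.symm ⟨x, by rw [mem_rootSet]; exact ⟨hf.ne_zero, hx⟩⟩, by simp [z]⟩
  have hzroot : ∀ j, aeval (z j) f = 0 := fun j => (mem_rootSet.mp (e j).2).2
  have hroots : f.aroots K = Finset.univ.val.map z := by
    refine (Multiset.Nodup.ext (nodup_roots hsep.map) (Finset.univ.nodup.map hinj)).mpr fun x => ?_
    rw [mem_aroots, Multiset.mem_map]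
    constructor
    · rintro ⟨-, hx⟩
      obtain ⟨j, hj⟩ := hrange x hx
      exact ⟨j, Finset.mem_univ j, hj⟩
    · rintro ⟨j, -, rfl⟩
      exact ⟨hf.ne_zero, hzroot j⟩
  have hz : f.map (algebraMap F K) = ∏ j, (X - C (z j)) := by
    rw [hsplit.eq_prod_roots_of_monic (hf.map _), ← aroots_def, hroots, Multiset.map_map]
    rfl
  have hfrob : ∀ j, ∃ k, z k = z j ^ Fintype.card F := fun j => hrange _ <| by
    have h := aeval_algHom_apply (FiniteField.frobeniusAlgHom F K) (z j) f
    rwa [hzroot, map_zero, FiniteField.coe_frobeniusAlgHom] at h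
  choose p hp using hfrob
  have hp_inj : Function.Injective p := fun i j h => hinj <| by
    have h' : z i ^ Fintype.card F = z j ^ Fintype.card F := by rw [← hp, ← hp, h]
    exact (FiniteField.frobeniusAlgHom F K).toRingHom.injective h'
  let π : Equiv.Perm (Fin n) := Equiv.ofBijective p (Finite.injective_iff_bijective.mp hp_inj)
  have hπ : ∀ j, z j ^ Fintype.card F = z (π j) := fun j => (hp j).symm
  have hset : {w : Fin n → K | f.map (algebraMap F K) = ∏ j, (X - C (w j)) ∧
        ∀ j, w j ^ Fintype.card F = w (σ j)} =
      (fun τ : Equiv.Perm (Fin n) => z ∘ τ) '' {τ | SemiconjBy τ σ π} := by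
    ext w
    simp only [Set.mem_ofPred_eq, Set.mem_image]
    constructor
    · rintro ⟨hw, hwσ⟩
      have hwroots : Finset.univ.val.map w = Finset.univ.val.map z := by
        rw [← hroots, aroots_def, hw, roots_fintype_prod_X_sub_C]
      have hwinj : Function.Injective w := by
        have hnodup := Finset.univ.nodup.map hinj
        rw [← hwroots, Multiset.nodup_map_iff_inj_on Finset.univ.nodup] at hnodup
        exact fun i j h => hnodup i (Finset.mem_univ i) j (Finset.mem_univ j) h
      have hex : ∀ j, ∃ k, z k = w j := fun j => by
        have : w j ∈ Finset.univ.val.map z := by simp [← hwroots]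
        simpa using this
      choose t ht using hex
      have ht_inj : Function.Injective t := fun i j h => hwinj <| by rw [← ht, ← ht, h]
      refine ⟨Equiv.ofBijective t (Finite.injective_iff_bijective.mp ht_inj), ?_, funext ht⟩
      ext1 j
      refine hinj ?_
      change z (t (σ j)) = z (π (t j))
      rw [ht, ← hπ, ht, hwσ]
    · rintro ⟨τ, hτ, rfl⟩
      refine ⟨?_, fun j => ?_⟩
      · rw [hz]
        exact (Equiv.prod_comp τ fun j => X - C (z j)).symm
      · have := Equiv.congr_fun hτ.eq j
        simp only [Equiv.Perm.mul_apply] at this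
        simp only [Function.comp_apply, hπ, this]
  have hcomp_inj : Function.Injective fun τ : Equiv.Perm (Fin n) => z ∘ τ := fun τ τ' h =>
    Equiv.ext fun j => hinj (congrFun h j)
  rw [hset, Set.ncard_image_of_injective _ hcomp_inj, Equiv.Perm.ncard_setOf_semiconjBy,
    FiniteField.map_natDegree_normalizedFactors_eq hsep hz hinj hπ]
  refine if_congr ?_ rfl rfl
  rw [isConj_comm, Equiv.Perm.partition_eq_of_isConj, Nat.Partition.ext_iff,
    Equiv.Perm.parts_partition (σ := σ)]
  simp only [Fintype.card_fin]
end
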